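/- arXiv:1303.1998 — 2 statements merged into one kernel-verified Lean document; each statement's English description precedes it below -/
import Mathlib

section
/- Let q be a prime power, f ∈ F_q[t][x] with deg_x f = d ≥ 1 which is separable and squarefree as a polynomial in x over F_q(t) (i.e., gcd(f, ∂f/∂x) = 1 in F_q(t)[x]), and let ℓ ∈ F_q[t] be a monic irreducible polynomial not dividing the gcd of the coefficients f_0, …, f_d of f. Then: (1) the series Σ_{(r,k) ∈ S(f,ℓ)} Norm(ℓ)^{−k} converges; (2) both averages A(v_ℓ(P), {P ∈ F_q[t], P ≠ 0}) and A(v_ℓ(F(a,b)), {(a,b) ∈ F_q[t]² : gcd(a,b) = 1, F(a,b) ≠ 0}) exist, so that α_ℓ(f) is well defined; and (3) α_ℓ(f) = deg ℓ · ( 1/(Norm(ℓ) − 1) − (Norm(ℓ)/(Norm(ℓ)+1)) · Σ_{(r,k) ∈ S(f,ℓ)} Norm(ℓ)^{−k} ). -/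
open Polynomial Filter

/-- The homogenization `F(a,b)` of `f ∈ F_q[t][x]` evaluated at polynomials `a, b`. -/
noncomputable def homogEval {Fq : Type*} [Field Fq] (f : Polynomial (Polynomial Fq))
    (a b : Polynomial Fq) : Polynomial Fq :=
  ∑ i ∈ Finset.range (f.natDegree + 1), f.coeff i * a ^ i * b ^ (f.natDegree - i)

/-- The set `S(f,ℓ)` of affine (tag `true`) and projective (tag `false`) roots `(r,k)` of
`f` modulo powers `ℓ^k` of `ℓ`. -/
noncomputable def rootPairs {Fq : Type*} [Field Fq] (f : Polynomial (Polynomial Fq))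
    (ℓ : Polynomial Fq) : Set (Bool × Polynomial Fq × ℕ) :=
  {x | 1 ≤ x.2.2 ∧ x.2.1.degree < ((x.2.2 * ℓ.natDegree : ℕ) : WithBot ℕ) ∧
    ((x.1 = true ∧ ℓ ^ x.2.2 ∣ f.eval x.2.1) ∨
     (x.1 = false ∧ ℓ ∣ x.2.1 ∧ ℓ ^ x.2.2 ∣ homogEval f 1 x.2.1))}


namespace AlphaEll

section

open scoped Classical

variable {Fq : Type*} [Field Fq]

section Counting

variable [Fintype Fq]

/-- The finite set of polynomials of degree `< m` over a finite field. -/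
noncomputable def polysLT (Fq : Type*) [Field Fq] [Fintype Fq] (m : ℕ) : Finset Fq[X] :=
  Finset.univ.map ⟨fun c : Fin m → Fq => ((degreeLTEquiv Fq m).symm c : Fq[X]),
    Subtype.val_injective.comp (degreeLTEquiv Fq m).symm.injective⟩

lemma mem_polysLT {m : ℕ} {P : Fq[X]} : P ∈ polysLT Fq m ↔ P.degree < (m : WithBot ℕ) := by
  rw [← Polynomial.mem_degreeLT]
  simp only [polysLT, Finset.mem_map, Finset.mem_univ, true_and, Function.Embedding.coeFn_mk]
  constructor
  · rintro ⟨c, rfl⟩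
    exact Subtype.mem _
  · intro h
    exact ⟨degreeLTEquiv Fq m ⟨P, h⟩,
      congrArg Subtype.val ((degreeLTEquiv Fq m).symm_apply_apply ⟨P, h⟩)⟩

lemma card_polysLT (m : ℕ) : (polysLT Fq m).card = Fintype.card Fq ^ m := by
  simp [polysLT]

lemma mul_mem_polysLT_iff {m : ℕ} {g a : Fq[X]} (hg : g ≠ 0) (hm : g.natDegree ≤ m) :
    g * a ∈ polysLT Fq m ↔ a ∈ polysLT Fq (m - g.natDegree) := by
  rw [mem_polysLT, mem_polysLT]
  rcases eq_or_ne a 0 with rfl | ha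
  · simp
  · rw [← natDegree_lt_iff_degree_lt (mul_ne_zero hg ha), ← natDegree_lt_iff_degree_lt ha,
      natDegree_mul hg ha]
    omega

lemma card_filter_modEq {m : ℕ} {M : Fq[X]} (hM : M.Monic) (hm : M.natDegree ≤ m) (c : Fq[X]) :
    ((polysLT Fq m).filter (fun a => M ∣ a - c)).card = Fintype.card Fq ^ (m - M.natDegree) := by
  have hinj : Function.Injective (fun s : Fq[X] => c %ₘ M + M * s) := fun s s' h =>
    mul_left_cancel₀ hM.ne_zero (add_left_cancel h)
  rw [← card_polysLT, ← Finset.card_image_of_injective (polysLT Fq (m - M.natDegree)) hinj]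
  congr 1
  have hmod : c %ₘ M ∈ polysLT Fq m := by
    rw [mem_polysLT]
    refine (degree_modByMonic_lt c hM).trans_le ?_
    rw [degree_eq_natDegree hM.ne_zero]
    exact_mod_cast hm
  have hadd : ∀ s, c %ₘ M + M * s ∈ polysLT Fq m ↔ s ∈ polysLT Fq (m - M.natDegree) := by
    intro s
    rw [← mul_mem_polysLT_iff hM.ne_zero hm]
    rw [mem_polysLT, ← Polynomial.mem_degreeLT] at hmod ⊢
    rw [mem_polysLT, ← Polynomial.mem_degreeLT]
    exact Submodule.add_mem_iff_right _ hmod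
  have hdvd : M ∣ c %ₘ M - c := ⟨-(c /ₘ M), by
    linear_combination (modByMonic_add_div c M)⟩
  ext a
  simp only [Finset.mem_filter, Finset.mem_image]
  constructor
  · rintro ⟨ha, hac⟩
    obtain ⟨s, hs⟩ : M ∣ a - c %ₘ M := by
      have := dvd_sub hac hdvd
      simpa using this
    have hs' : c %ₘ M + M * s = a := by rw [← hs]; ring
    exact ⟨s, (hadd s).1 (hs' ▸ ha), hs'⟩
  · rintro ⟨s, hs, rfl⟩
    refine ⟨(hadd s).2 hs, ?_⟩
    have := dvd_add hdvd (dvd_mul_right M s)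
    convert this using 1
    ring

/-- Counting pairs whose ratio lies in a prescribed set of residue classes modulo `ℓ ^ k`. -/
lemma card_filter_ratio_mem {ℓ : Fq[X]} (hmonic : ℓ.Monic) (hirr : Irreducible ℓ) {m k : ℕ}
    (hk : 1 ≤ k) (hm : k * ℓ.natDegree ≤ m) (R : Finset Fq[X])
    (hR : R ⊆ polysLT Fq (k * ℓ.natDegree)) :
    ((polysLT Fq m ×ˢ polysLT Fq m).filter
      (fun p => ¬ ℓ ∣ p.2 ∧ ∃ r ∈ R, ℓ ^ k ∣ p.1 - r * p.2)).card =
    (Fintype.card Fq ^ m - Fintype.card Fq ^ (m - ℓ.natDegree)) *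
      (R.card * Fintype.card Fq ^ (m - k * ℓ.natDegree)) := by
  have hMm : (ℓ ^ k).Monic := hmonic.pow k
  have hMd : (ℓ ^ k).natDegree = k * ℓ.natDegree := hmonic.natDegree_pow k
  have hnm : ℓ.natDegree ≤ m := le_trans (Nat.le_mul_of_pos_left _ hk) hm
  have hB : ((polysLT Fq m).filter (fun b => ¬ ℓ ∣ b)).card =
      Fintype.card Fq ^ m - Fintype.card Fq ^ (m - ℓ.natDegree) := by
    have h1 := card_filter_modEq (Fq := Fq) hmonic hnm 0
    have h2 := Finset.card_filter_add_card_filter_not (s := polysLT Fq m) (fun b => ℓ ∣ b)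
    simp only [sub_zero] at h1
    rw [card_polysLT] at h2
    omega
  rw [← hB, Finset.card_filter, Finset.sum_product_right, Finset.card_filter, Finset.sum_mul]
  refine Finset.sum_congr rfl fun b _ => ?_
  by_cases hb : ℓ ∣ b
  · simp [hb]
  simp only [hb, not_false_eq_true, true_and, if_true, one_mul]
  rw [← Finset.card_filter]
  have hunion : (polysLT Fq m).filter (fun a => ∃ r ∈ R, ℓ ^ k ∣ a - r * b) =
      R.biUnion (fun r => (polysLT Fq m).filter (fun a => ℓ ^ k ∣ a - r * b)) := by
    ext a
    simp only [Finset.mem_filter, Finset.mem_biUnion]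
    tauto
  rw [hunion, Finset.card_biUnion]
  · rw [Finset.sum_congr rfl (fun r _ => card_filter_modEq hMm (hMd ▸ hm) (r * b)),
      Finset.sum_const, smul_eq_mul, hMd]
  · intro r hr s hs hrs
    rw [Function.onFun, Finset.disjoint_left]
    intro a ha ha'
    simp only [Finset.mem_filter] at ha ha'
    apply hrs
    have h1 : ℓ ^ k ∣ (r - s) * b := by
      have := dvd_sub ha'.2 ha.2
      convert this using 1
      ring
    have hcop : IsCoprime (ℓ ^ k) b := ((hirr.coprime_iff_not_dvd).2 hb).pow_left
    have h2 : ℓ ^ k ∣ r - s := hcop.dvd_of_dvd_mul_right h1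
    have h3 : (r - s).degree < (ℓ ^ k).degree := by
      rw [degree_eq_natDegree hMm.ne_zero, hMd]
      refine (degree_sub_le r s).trans_lt (max_lt ?_ ?_)
      · exact mem_polysLT.1 (hR hr)
      · exact mem_polysLT.1 (hR hs)
    exact sub_eq_zero.1 (eq_zero_of_dvd_of_degree_lt h2 h3)

end Counting

section HomogEval

variable (f : Fq[X][X])

lemma homogEval_one_right (r : Fq[X]) : homogEval f r 1 = f.eval r := by
  simp [homogEval, eval_eq_sum_range]

lemma homogEval_eq_eval_scaleRoots (a b : Fq[X]) :
    homogEval f a b = (f.scaleRoots b).eval a := by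
  rw [eval_eq_sum_range, natDegree_scaleRoots, homogEval]
  exact Finset.sum_congr rfl fun i _ => by rw [coeff_scaleRoots]; ring

lemma homogEval_one_left (r : Fq[X]) : homogEval f 1 r = f.reverse.eval r := by
  rw [eval_eq_sum_range' (Nat.lt_succ_of_le (reverse_natDegree_le f)), homogEval,
    ← Finset.sum_range_reflect]
  refine Finset.sum_congr rfl fun i hi => ?_
  have hi' : i ≤ f.natDegree := Nat.lt_succ_iff.1 (Finset.mem_range.1 hi)
  rw [coeff_reverse, revAt_le hi']
  simp only [one_pow, mul_one, Nat.add_sub_cancel, Nat.sub_sub_self hi']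

lemma homogEval_mul (g a b : Fq[X]) :
    homogEval f (g * a) (g * b) = g ^ f.natDegree * homogEval f a b := by
  rw [homogEval, homogEval, Finset.mul_sum]
  refine Finset.sum_congr rfl fun i hi => ?_
  have hi' : i ≤ f.natDegree := Nat.lt_succ_iff.1 (Finset.mem_range.1 hi)
  obtain ⟨j, hj⟩ := Nat.exists_eq_add_of_le hi'
  rw [hj, Nat.add_sub_cancel_left]
  ring

lemma dvd_homogEval_iff_left {M a b r : Fq[X]} (h : M ∣ a - r * b) (hM : IsCoprime M b) :
    M ∣ homogEval f a b ↔ M ∣ f.eval r := by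
  have h1 : M ∣ homogEval f a b - homogEval f (r * b) b := by
    rw [homogEval_eq_eval_scaleRoots, homogEval_eq_eval_scaleRoots]
    exact h.trans (sub_dvd_eval_sub _ _ _)
  have h2 : homogEval f (r * b) b = b ^ f.natDegree * f.eval r := by
    rw [← homogEval_one_right, ← homogEval_mul, mul_one, mul_comm]
  rw [dvd_iff_dvd_of_dvd_sub h1, h2]
  exact ⟨hM.pow_right.dvd_of_dvd_mul_left, fun h => h.mul_left _⟩

lemma dvd_homogEval_iff_right {M a b r : Fq[X]} (h : M ∣ b - r * a) (hM : IsCoprime M a) :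
    M ∣ homogEval f a b ↔ M ∣ homogEval f 1 r := by
  have h1 : M ∣ homogEval f a b - homogEval f a (r * a) := by
    rw [homogEval, homogEval, ← Finset.sum_sub_distrib]
    refine Finset.dvd_sum fun i _ => ?_
    rw [← mul_sub]
    exact (h.trans (sub_dvd_pow_sub_pow _ _ _)).mul_left _
  have h2 : homogEval f a (r * a) = a ^ f.natDegree * homogEval f 1 r := by
    rw [← homogEval_mul, mul_one, mul_comm]
  rw [dvd_iff_dvd_of_dvd_sub h1, h2]
  exact ⟨hM.pow_right.dvd_of_dvd_mul_left, fun h => h.mul_left _⟩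

lemma natDegree_homogEval_le {m : ℕ} {a b : Fq[X]} (ha : a.natDegree ≤ m) (hb : b.natDegree ≤ m) :
    (homogEval f a b).natDegree ≤
      f.natDegree * m + (Finset.range (f.natDegree + 1)).sup (fun i => (f.coeff i).natDegree) := by
  refine natDegree_sum_le_of_forall_le _ _ fun i hi => ?_
  have h1 : (f.coeff i).natDegree ≤
      (Finset.range (f.natDegree + 1)).sup (fun i => (f.coeff i).natDegree) :=
    Finset.le_sup (f := fun i => (f.coeff i).natDegree) hi
  have hi' : i ≤ f.natDegree := Nat.lt_succ_iff.1 (Finset.mem_range.1 hi)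
  obtain ⟨j, hj⟩ := Nat.exists_eq_add_of_le hi'
  have h2 : (f.coeff i * a ^ i * b ^ (f.natDegree - i)).natDegree ≤
      (f.coeff i).natDegree + i * m + (f.natDegree - i) * m := by
    refine natDegree_mul_le.trans (Nat.add_le_add (natDegree_mul_le.trans
      (Nat.add_le_add le_rfl ?_)) ?_)
    · exact natDegree_pow_le.trans (Nat.mul_le_mul_left _ ha)
    · exact natDegree_pow_le.trans (Nat.mul_le_mul_left _ hb)
  have h3 : i * m + (f.natDegree - i) * m = f.natDegree * m := by
    rw [← add_mul, Nat.add_sub_cancel' hi']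
  omega

variable {f}

lemma card_filter_homogEval_eq_zero_le [Fintype Fq] (hf : f ≠ 0) (m : ℕ) :
    ((polysLT Fq m ×ˢ polysLT Fq m).filter (fun p => homogEval f p.1 p.2 = 0)).card ≤
      f.natDegree * Fintype.card Fq ^ m := by
  rw [Finset.card_filter, Finset.sum_product_right, ← card_polysLT (Fq := Fq) m, mul_comm,
    ← smul_eq_mul]
  refine Finset.sum_le_card_nsmul _ _ _ fun b _ => ?_
  rw [← Finset.card_filter, ← natDegree_scaleRoots f b]
  have hne : f.scaleRoots b ≠ 0 := scaleRoots_ne_zero hf b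
  refine le_trans (Finset.card_le_card (t := (f.scaleRoots b).roots.toFinset) fun a ha => ?_)
    ((Multiset.toFinset_card_le _).trans (card_roots' _))
  rw [Finset.mem_filter, homogEval_eq_eval_scaleRoots] at ha
  rw [Multiset.mem_toFinset, mem_roots hne]
  exact ha.2

end HomogEval

section RootBound

/-- Euler's identity relating the derivatives of a polynomial and of its reverse. -/
lemma aeval_derivative_mul_pow_of_reverse {K L : Type*} [Field K] [Field L] [Algebra K L]
    (p : K[X]) {x : L} (hx : x ≠ 0) :
    aeval x⁻¹ (derivative p) * x ^ p.natDegree =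
      x * (p.natDegree * aeval x p.reverse - x * aeval x (derivative p.reverse)) := by
  have h1 : ∀ y : L, aeval y p.reverse =
      ∑ i ∈ Finset.range (p.natDegree + 1), algebraMap K L (p.coeff i) * y ^ (p.natDegree - i) := by
    intro y
    rw [aeval_eq_sum_range' (Nat.lt_succ_of_le (reverse_natDegree_le p)),
      ← Finset.sum_range_reflect]
    refine Finset.sum_congr rfl fun i hi => ?_
    have hi' : i ≤ p.natDegree := Nat.lt_succ_iff.1 (Finset.mem_range.1 hi)
    rw [Nat.succ_sub_one, coeff_reverse, revAt_le (Nat.sub_le _ _), Nat.sub_sub_self hi', Algebra.smul_def]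
  have hrev : p.reverse =
      ∑ i ∈ Finset.range (p.natDegree + 1), C (p.coeff i) * X ^ (p.natDegree - i) := by
    rw [as_sum_range_C_mul_X_pow' p.reverse (Nat.lt_succ_of_le (reverse_natDegree_le p)),
      ← Finset.sum_range_reflect]
    refine Finset.sum_congr rfl fun i hi => ?_
    have hi' : i ≤ p.natDegree := Nat.lt_succ_iff.1 (Finset.mem_range.1 hi)
    rw [Nat.succ_sub_one, coeff_reverse, revAt_le (Nat.sub_le _ _), Nat.sub_sub_self hi']
  have h2 : x * aeval x (derivative p.reverse) = ∑ i ∈ Finset.range (p.natDegree + 1),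
      algebraMap K L (p.coeff i) * ((p.natDegree - i : ℕ) : L) * x ^ (p.natDegree - i) := by
    conv_lhs => rw [hrev]
    simp only [map_sum, Finset.mul_sum]
    refine Finset.sum_congr rfl fun i _ => ?_
    rw [derivative_C_mul_X_pow]
    simp only [map_mul, aeval_C, map_natCast, map_pow, aeval_X]
    rcases p.natDegree - i with _ | j
    · simp
    · simp only [Nat.add_sub_cancel]
      ring
  have h3 : aeval x⁻¹ (derivative p) * x ^ p.natDegree =
      x * ∑ i ∈ Finset.range (p.natDegree + 1),
        algebraMap K L (p.coeff i) * (i : L) * x ^ (p.natDegree - i) := by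
    conv_lhs => arg 1; rw [as_sum_range_C_mul_X_pow p]
    simp only [map_sum, Finset.mul_sum, Finset.sum_mul]
    refine Finset.sum_congr rfl fun i hi => ?_
    have hi' : i ≤ p.natDegree := Nat.lt_succ_iff.1 (Finset.mem_range.1 hi)
    obtain ⟨j, hj⟩ := Nat.exists_eq_add_of_le hi'
    rw [derivative_C_mul_X_pow]
    simp only [map_mul, aeval_C, map_natCast, map_pow, aeval_X]
    rw [hj, Nat.add_sub_cancel_left]
    rcases i with _ | i
    · simp
    · have hxi : x⁻¹ ^ i * x ^ i = 1 := by rw [← mul_pow, inv_mul_cancel₀ hx, one_pow]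
      simp only [Nat.add_sub_cancel]
      linear_combination
        (algebraMap K L (p.coeff (i + 1)) * ((i + 1 : ℕ) : L) * x * x ^ j) * hxi
  rw [h1, h2, h3, Finset.mul_sum (a := (p.natDegree : L)), ← Finset.sum_sub_distrib]
  congr 1
  refine Finset.sum_congr rfl fun i hi => ?_
  have hi' : i ≤ p.natDegree := Nat.lt_succ_iff.1 (Finset.mem_range.1 hi)
  rw [Nat.cast_sub hi']
  ring

lemma separable_reverse {K : Type*} [Field K] {p : K[X]} (hp : p.Separable) :
    p.reverse.Separable := by
  refine (isCoprime_iff_aeval_ne_zero_of_isAlgClosed K (AlgebraicClosure K) _ _).2 ?_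
  by_contra! h
  obtain ⟨x, hx, hx'⟩ := h
  have hx0 : x ≠ 0 := by
    rintro rfl
    rw [← coeff_zero_eq_aeval_zero', coeff_zero_reverse] at hx
    exact hp.ne_zero (leadingCoeff_eq_zero.1 ((map_eq_zero _).1 hx))
  have h1 := aeval_derivative_mul_pow_of_reverse p hx0
  rw [hx, hx', mul_zero, mul_zero, sub_zero, mul_zero] at h1
  have h2 : aeval x⁻¹ p = 0 := by
    let _ : Invertible x⁻¹ := invertibleOfNonzero (inv_ne_zero hx0)
    rw [aeval_def, ← eval₂_reverse_eq_zero_iff]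
    simpa [aeval_def] using hx
  rcases (isCoprime_iff_aeval_ne_zero_of_isAlgClosed K (AlgebraicClosure K) _ _).1 hp x⁻¹ with h | h
  · exact h h2
  · exact h ((mul_eq_zero.1 h1).resolve_right (pow_ne_zero _ hx0))

lemma reverse_map_of_injective {R S : Type*} [Semiring R] [Semiring S] {φ : R →+* S}
    (hφ : Function.Injective φ) (p : R[X]) : (p.map φ).reverse = p.reverse.map φ := by
  rw [reverse, reverse, natDegree_map_eq_of_injective hφ, reflect_map]

lemma exists_bezout_of_separable {R K : Type*} [CommRing R] [IsDomain R] [Field K] [Algebra R K]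
    [IsFractionRing R K] {g : R[X]} (hg : (g.map (algebraMap R K)).Separable) :
    ∃ (u v : R[X]) (c : R), c ≠ 0 ∧ u * g + v * derivative g = C c := by
  obtain ⟨u, v, huv⟩ := hg
  obtain ⟨b, hb, hu⟩ := IsLocalization.integerNormalization_spec (nonZeroDivisors R) u
  obtain ⟨b', hb', hv⟩ := IsLocalization.integerNormalization_spec (nonZeroDivisors R) v
  set u₀ := IsLocalization.integerNormalization (nonZeroDivisors R) u
  set v₀ := IsLocalization.integerNormalization (nonZeroDivisors R) v
  refine ⟨C b' * u₀, C b * v₀, b * b', nonZeroDivisors.ne_zero (mul_mem hb hb'), ?_⟩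
  apply Polynomial.map_injective (algebraMap R K) (IsFractionRing.injective R K)
  have hs : ∀ (r : R) (p : K[X]), r • p = C (algebraMap R K r) * p := fun r p => by
    rw [← smul_eq_C_mul, algebraMap_smul]
  simp only [Polynomial.map_add, Polynomial.map_mul, map_C, hu, hv, ← derivative_map, hs, map_mul]
  linear_combination (C (algebraMap R K b) * C (algebraMap R K b')) * huv

variable [Fintype Fq]

lemma exists_card_roots_le {ℓ : Fq[X]} (hmonic : ℓ.Monic) (hirr : Irreducible ℓ)
    {u v g : Fq[X][X]} {c : Fq[X]} (hc : c ≠ 0) (h : u * g + v * derivative g = C c) :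
    ∃ B : ℕ, ∀ k, ((polysLT Fq (k * ℓ.natDegree)).filter (fun r => ℓ ^ k ∣ g.eval r)).card ≤ B := by
  obtain ⟨e, he⟩ : FiniteMultiplicity ℓ c := FiniteMultiplicity.of_prime_left hirr.prime hc
  have hq : 0 < Fintype.card Fq := Fintype.card_pos
  refine ⟨Fintype.card Fq ^ (e * ℓ.natDegree) * Fintype.card Fq ^ ((e + 1) * ℓ.natDegree),
    fun k => ?_⟩
  rcases Nat.lt_or_ge e k with hk | hk
  swap
  · refine (Finset.card_filter_le _ _).trans ?_
    rw [card_polysLT]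
    refine le_trans (Nat.pow_le_pow_right hq (Nat.mul_le_mul_right _ hk))
      (Nat.le_mul_of_pos_right _ (pow_pos hq _))
  have hM := hmonic.pow (e + 1)
  have hMd : (ℓ ^ (e + 1)).natDegree = (e + 1) * ℓ.natDegree := hmonic.natDegree_pow _
  rw [← card_polysLT (Fq := Fq) ((e + 1) * ℓ.natDegree)]
  refine Finset.card_le_mul_card_image_of_maps_to (f := fun r => r %ₘ ℓ ^ (e + 1)) ?_ _ ?_
  · intro r _
    rw [mem_polysLT, ← hMd, ← degree_eq_natDegree hM.ne_zero]
    exact degree_modByMonic_lt _ hM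
  intro t _
  rw [Finset.filter_filter]
  rcases Finset.eq_empty_or_nonempty ((polysLT Fq (k * ℓ.natDegree)).filter
    (fun r => ℓ ^ k ∣ g.eval r ∧ r %ₘ ℓ ^ (e + 1) = t)) with h0 | ⟨s, hs⟩
  · rw [h0]; simp
  rw [Finset.mem_filter] at hs
  have hN := hmonic.pow (k - e)
  have hNd : (ℓ ^ (k - e)).natDegree = (k - e) * ℓ.natDegree := hmonic.natDegree_pow _
  have hle : (ℓ ^ (k - e)).natDegree ≤ k * ℓ.natDegree :=
    hNd ▸ Nat.mul_le_mul_right _ (Nat.sub_le _ _)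
  have hcard := card_filter_modEq (Fq := Fq) hN hle s
  rw [hNd, ← Nat.sub_mul, Nat.sub_sub_self hk.le] at hcard
  rw [← hcard]
  refine Finset.card_le_card fun r hr => ?_
  rw [Finset.mem_filter] at hr ⊢
  refine ⟨hr.1, ?_⟩
  have hrs : ℓ ^ (e + 1) ∣ r - s := by
    rw [← modByMonic_eq_zero_iff_dvd hM, sub_modByMonic, hr.2.2, hs.2.2, sub_self]
  have hder : ¬ ℓ ^ (e + 1) ∣ g.derivative.eval s := by
    intro hd
    apply he
    have := congrArg (eval s) h
    rw [eval_add, eval_mul, eval_mul, eval_C] at this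
    rw [← this]
    exact dvd_add (((pow_dvd_pow ℓ hk).trans hs.2.1).mul_left _) (hd.mul_left _)
  obtain ⟨z, hz⟩ := g.binomExpansion s (r - s)
  rw [add_sub_cancel] at hz
  have hdvd : ℓ ^ k ∣ (r - s) * (g.derivative.eval s + z * (r - s)) := by
    have := dvd_sub hr.2.1 hs.2.1
    rw [hz] at this
    convert this using 1
    ring
  have hw : ¬ ℓ ^ (e + 1) ∣ g.derivative.eval s + z * (r - s) := fun hd =>
    hder ((dvd_add_left (hrs.mul_left z)).1 hd)
  have hw0 : g.derivative.eval s + z * (r - s) ≠ 0 := fun h0 => hw (h0 ▸ dvd_zero _)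
  obtain ⟨w, hw1, hw2⟩ :=
    (FiniteMultiplicity.of_prime_left hirr.prime hw0).exists_eq_pow_mul_and_not_dvd
  set i := multiplicity ℓ (g.derivative.eval s + z * (r - s))
  have hi : i ≤ e := by
    by_contra hie
    exact hw (hw1 ▸ (pow_dvd_pow ℓ (by omega)).mul_right _)
  rw [hw1, ← mul_assoc] at hdvd
  have h1 := hirr.prime.pow_dvd_of_dvd_mul_right k hw2 hdvd
  rw [← Nat.sub_add_cancel (hi.trans hk.le), pow_add] at h1
  have h2 := (mul_dvd_mul_iff_right (pow_ne_zero i hirr.ne_zero)).1 h1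
  exact (pow_dvd_pow ℓ (Nat.sub_le_sub_left hi k)).trans h2

end RootBound

section Recurrence

/-- A sequence satisfying a contracting affine recurrence with converging source converges. -/
lemma tendsto_of_contracting_recurrence {y h : ℕ → ℝ} {n : ℕ} (hn : 0 < n) {c L : ℝ}
    (hc0 : 0 ≤ c) (hc1 : c < 1) (hrec : ∀ j, 1 ≤ j → y (j + n) = c * y j + h j)
    (hh : Tendsto h atTop (nhds L)) : Tendsto y atTop (nhds (L / (1 - c))) := by
  have hc : 0 < 1 - c := by linarith
  rw [Metric.tendsto_atTop]
  intro ε hε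
  obtain ⟨N, hN⟩ := Metric.tendsto_atTop.1 hh (ε / 2 * (1 - c)) (by positivity)
  set z : ℕ → ℝ := fun j => y j - L / (1 - c) with hz
  have hzrec : ∀ j, N + 1 ≤ j → |z (j + n)| ≤ c * |z j| + ε / 2 * (1 - c) := by
    intro j hj
    have h1 : z (j + n) = c * z j + (h j - L) := by
      simp only [hz]
      rw [hrec j (by omega)]
      field_simp
      ring
    have h2 := (hN j (by omega)).le
    rw [Real.dist_eq] at h2
    rw [h1]
    calc |c * z j + (h j - L)| ≤ |c * z j| + |h j - L| := abs_add_le _ _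
      _ ≤ _ := by rw [abs_mul, abs_of_nonneg hc0]; linarith
  set B := ∑ i ∈ Finset.range n, |z (N + 1 + i)| with hB
  have hclaim : ∀ k, ∀ i < n, |z (N + 1 + i + k * n)| ≤ c ^ k * B + ε / 2 := by
    intro k
    induction k with
    | zero =>
      intro i hi
      have : |z (N + 1 + i)| ≤ B :=
        Finset.single_le_sum (f := fun i => |z (N + 1 + i)|) (fun _ _ => abs_nonneg _)
          (Finset.mem_range.2 hi)
      simp only [zero_mul, add_zero, pow_zero, one_mul]
      linarith
    | succ k ih =>
      intro i hi
      have h1 := hzrec (N + 1 + i + k * n) (by omega)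
      have h2 := mul_le_mul_of_nonneg_left (ih i hi) hc0
      rw [show N + 1 + i + (k + 1) * n = N + 1 + i + k * n + n by ring, pow_succ]
      linarith
  have hlim : Tendsto (fun k => c ^ k * B) atTop (nhds 0) := by
    simpa using (tendsto_pow_atTop_nhds_zero_of_lt_one hc0 hc1).mul_const B
  obtain ⟨k₀, hk₀⟩ := (hlim.eventually (gt_mem_nhds (half_pos hε))).exists_forall_of_atTop
  refine ⟨N + 1 + k₀ * n, fun m hm => ?_⟩
  rw [Real.dist_eq]
  have hk : k₀ ≤ (m - (N + 1)) / n := by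
    rw [Nat.le_div_iff_mul_le hn]
    omega
  have hmod := Nat.mod_add_div' (m - (N + 1)) n
  have h1 := hclaim ((m - (N + 1)) / n) ((m - (N + 1)) % n) (Nat.mod_lt _ hn)
  rw [add_assoc (N + 1), hmod, Nat.add_sub_cancel' (by omega)] at h1
  have h2 := hk₀ _ hk
  simp only [hz] at h1
  linarith

lemma dvd_of_mul_eq_mul_of_isCoprime {R : Type*} [CommRing R] {g h a b a' b' : R}
    (hab : IsCoprime a b) (h1 : g * a = h * a') (h2 : g * b = h * b') : h ∣ g := by
  obtain ⟨u, v, huv⟩ := hab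
  exact ⟨u * a' + v * b', by linear_combination -g * huv + u * h1 + v * h2⟩

lemma exists_monic_mul_isCoprime {a b : Fq[X]} (hab : ¬ (a = 0 ∧ b = 0)) :
    ∃ g a' b' : Fq[X], g.Monic ∧ IsCoprime a' b' ∧ g * a' = a ∧ g * b' = b := by
  have hne : GCDMonoid.gcd a b ≠ 0 := fun h => hab ((gcd_eq_zero_iff a b).1 h)
  obtain ⟨g, hg, hassoc⟩ : ∃ g : Fq[X], g.Monic ∧ Associated (GCDMonoid.gcd a b) g :=
    ⟨normalize (GCDMonoid.gcd a b), monic_normalize hne, (normalize_associated _).symm⟩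
  obtain ⟨a', ha⟩ : g ∣ a := hassoc.symm.dvd.trans (gcd_dvd_left a b)
  obtain ⟨b', hb⟩ : g ∣ b := hassoc.symm.dvd.trans (gcd_dvd_right a b)
  refine ⟨g, a', b', hg, ?_, ha.symm, hb.symm⟩
  obtain ⟨x, y, hxy⟩ := exists_gcd_eq_mul_add_mul a b
  obtain ⟨c, hc⟩ := hassoc.dvd
  refine ⟨x * c, y * c, mul_left_cancel₀ hg.ne_zero ?_⟩
  calc g * (x * c * a' + y * c * b') = (g * a' * x + g * b' * y) * c := by ring
    _ = GCDMonoid.gcd a b * c := by rw [← ha, ← hb, hxy]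
    _ = g * 1 := by rw [← hc, mul_one]

variable [Fintype Fq]

/-- Pairs of polynomials of degree `< m`, not both divisible by `ℓ`. -/
noncomputable def primitivePairs (ℓ : Fq[X]) (m : ℕ) : Finset (Fq[X] × Fq[X]) :=
  (polysLT Fq m ×ˢ polysLT Fq m).filter (fun p => ¬ (ℓ ∣ p.1 ∧ ℓ ∣ p.2))

/-- Coprime pairs of polynomials of degree `< m`. -/
noncomputable def coprimePairs (Fq : Type*) [Field Fq] [Fintype Fq] (m : ℕ) :
    Finset (Fq[X] × Fq[X]) :=
  (polysLT Fq m ×ˢ polysLT Fq m).filter (fun p => IsCoprime p.1 p.2)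

/-- Monic polynomials of degree `< m`. -/
noncomputable def monicsLT (Fq : Type*) [Field Fq] [Fintype Fq] (m : ℕ) : Finset Fq[X] :=
  (polysLT Fq m).filter Monic

lemma mem_monicsLT {m : ℕ} {g : Fq[X]} : g ∈ monicsLT Fq m ↔ g.natDegree < m ∧ g.Monic := by
  rw [monicsLT, Finset.mem_filter, mem_polysLT]
  refine and_congr_left fun hg => ?_
  rw [natDegree_lt_iff_degree_lt hg.ne_zero]

lemma sum_primitivePairs {ℓ : Fq[X]} (hirr : Irreducible ℓ) {φ : Fq[X] × Fq[X] → ℝ}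
    (hφ : ∀ g a b, ¬ ℓ ∣ g → φ (g * a, g * b) = φ (a, b)) (m : ℕ) :
    ∑ p ∈ primitivePairs ℓ m, φ p =
      ∑ g ∈ (monicsLT Fq m).filter (fun g => ¬ ℓ ∣ g),
        ∑ p ∈ coprimePairs Fq (m - g.natDegree), φ p := by
  rw [Finset.sum_sigma']
  symm
  refine Finset.sum_bij (fun x _ => (x.1 * x.2.1, x.1 * x.2.2)) ?_ ?_ ?_ ?_
  · rintro ⟨g, a, b⟩ h
    simp only [Finset.mem_sigma, Finset.mem_filter, mem_monicsLT, coprimePairs,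
      Finset.mem_product] at h
    obtain ⟨⟨⟨hgm, hg⟩, hlg⟩, ⟨ha, hb⟩, hab⟩ := h
    simp only [primitivePairs, Finset.mem_filter, Finset.mem_product,
      mul_mem_polysLT_iff hg.ne_zero hgm.le]
    refine ⟨⟨ha, hb⟩, fun h => ?_⟩
    exact hirr.not_isUnit (hab.isUnit_of_dvd' ((hirr.prime.dvd_or_dvd h.1).resolve_left hlg)
      ((hirr.prime.dvd_or_dvd h.2).resolve_left hlg))
  · rintro ⟨g, a, b⟩ h ⟨g', a', b'⟩ h' heq
    simp only [Finset.mem_sigma, Finset.mem_filter, mem_monicsLT, coprimePairs] at h h'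
    simp only [Prod.mk.injEq] at heq
    have hgg : g = g' := eq_of_monic_of_associated h.1.1.2 h'.1.1.2
      (associated_of_dvd_dvd
        (dvd_of_mul_eq_mul_of_isCoprime h'.2.2 heq.1.symm heq.2.symm)
        (dvd_of_mul_eq_mul_of_isCoprime h.2.2 heq.1 heq.2))
    subst hgg
    have hg0 := h.1.1.2.ne_zero
    rw [mul_left_cancel₀ hg0 heq.1, mul_left_cancel₀ hg0 heq.2]
  · rintro ⟨a, b⟩ h
    simp only [primitivePairs, Finset.mem_filter, Finset.mem_product] at h
    obtain ⟨g, a', b', hg, hcop, rfl, rfl⟩ := exists_monic_mul_isCoprime (a := a) (b := b)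
      (fun h0 => h.2 ⟨h0.1 ▸ dvd_zero _, h0.2 ▸ dvd_zero _⟩)
    have hgm : g.natDegree < m := by
      have key : ∀ c : Fq[X], c ≠ 0 → g * c ∈ polysLT Fq m → g.natDegree < m := by
        intro c hc hmem
        rw [mem_polysLT, ← natDegree_lt_iff_degree_lt (mul_ne_zero hg.ne_zero hc),
          natDegree_mul hg.ne_zero hc] at hmem
        omega
      by_cases ha0 : a' = 0
      · refine key b' (fun hb0 => ?_) h.1.2
        rw [ha0, hb0] at hcop
        exact not_isCoprime_zero_zero hcop
      · exact key a' ha0 h.1.1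
    rw [mul_mem_polysLT_iff hg.ne_zero hgm.le, mul_mem_polysLT_iff hg.ne_zero hgm.le] at h
    refine ⟨⟨g, a', b'⟩, ?_, rfl⟩
    simp only [Finset.mem_sigma, Finset.mem_filter, mem_monicsLT, coprimePairs,
      Finset.mem_product]
    exact ⟨⟨⟨hgm, hg⟩, fun hl => h.2 ⟨hl.mul_right _, hl.mul_right _⟩⟩, h.1, hcop⟩
  · rintro ⟨g, a, b⟩ h
    simp only [Finset.mem_sigma, Finset.mem_filter] at h
    exact (hφ g a b h.1.2).symm

lemma sum_monicsLT_succ (h : ℕ → ℝ) (m : ℕ) :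
    ∑ g ∈ monicsLT Fq (m + 1), h (m + 1 - g.natDegree) =
      h (m + 1) + Fintype.card Fq * ∑ g ∈ monicsLT Fq m, h (m - g.natDegree) := by
  have h1 : (1 : Fq[X]) ∈ monicsLT Fq (m + 1) := mem_monicsLT.2 ⟨by simp, monic_one⟩
  rw [← Finset.add_sum_erase _ _ h1, natDegree_one, Nat.sub_zero]
  congr 1
  have h2 : (Fintype.card Fq : ℝ) * ∑ g ∈ monicsLT Fq m, h (m - g.natDegree) =
      ∑ x ∈ (Finset.univ : Finset Fq) ×ˢ monicsLT Fq m, h (m - x.2.natDegree) := by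
    rw [Finset.sum_product]
    simp
  rw [h2]
  symm
  have hdeg : ∀ (c : Fq) {g : Fq[X]}, g.Monic →
      (X * g + C c).Monic ∧ (X * g + C c).natDegree = g.natDegree + 1 := by
    intro c g hg
    have hXg : (X * g).natDegree = g.natDegree + 1 := by
      rw [natDegree_X_mul hg.ne_zero]
    refine ⟨(monic_X.mul hg).add_of_left ?_, by rw [natDegree_add_C, hXg]⟩
    refine degree_C_le.trans_lt ?_
    rw [← natDegree_pos_iff_degree_pos, hXg]
    omega
  refine Finset.sum_bij (fun x _ => X * x.2 + C x.1) ?_ ?_ ?_ ?_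
  · rintro ⟨c, g⟩ hx
    simp only [Finset.mem_product, mem_monicsLT] at hx
    obtain ⟨hm, hd⟩ := hdeg c hx.2.2
    rw [Finset.mem_erase, mem_monicsLT]
    refine ⟨fun h0 => ?_, by simp only [hd]; omega, hm⟩
    rw [h0, natDegree_one] at hd
    omega
  · rintro ⟨c, g⟩ _ ⟨c', g'⟩ _ heq
    have hc : c = c' := by simpa using congrArg (fun p : Fq[X] => p.coeff 0) heq
    subst hc
    have hg : g = g' := mul_left_cancel₀ X_ne_zero (add_right_cancel heq)
    rw [hg]
  · intro p hp
    rw [Finset.mem_erase, mem_monicsLT] at hp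
    obtain ⟨hp1, hpm, hp⟩ := hp
    have hpd : p.natDegree ≠ 0 := fun h0 => hp1 (hp.natDegree_eq_zero.1 h0)
    refine ⟨(p.coeff 0, p.divX), ?_, X_mul_divX_add p⟩
    simp only [Finset.mem_product, Finset.mem_univ, true_and, mem_monicsLT]
    rw [natDegree_divX_eq_natDegree_tsub_one]
    refine ⟨by omega, ?_⟩
    rw [Monic, leadingCoeff, natDegree_divX_eq_natDegree_tsub_one, coeff_divX,
      Nat.sub_add_cancel (Nat.pos_of_ne_zero hpd)]
    exact hp
  · rintro ⟨c, g⟩ hx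
    simp only [Finset.mem_product, mem_monicsLT] at hx
    rw [(hdeg c hx.2.2).2, Nat.add_sub_add_right]

lemma sum_monicsLT_filter_dvd {ℓ : Fq[X]} (hmonic : ℓ.Monic) (h : ℕ → ℝ) {m : ℕ}
    (hm : ℓ.natDegree ≤ m) :
    ∑ g ∈ (monicsLT Fq m).filter (fun g => ℓ ∣ g), h (m - g.natDegree) =
      ∑ g ∈ monicsLT Fq (m - ℓ.natDegree), h (m - ℓ.natDegree - g.natDegree) := by
  symm
  refine Finset.sum_bij (fun g _ => ℓ * g) ?_ ?_ ?_ ?_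
  · intro g hg
    rw [mem_monicsLT] at hg
    rw [Finset.mem_filter, mem_monicsLT, hmonic.natDegree_mul hg.2]
    exact ⟨⟨by omega, hmonic.mul hg.2⟩, dvd_mul_right _ _⟩
  · exact fun g _ g' _ heq => mul_left_cancel₀ hmonic.ne_zero heq
  · intro p hp
    rw [Finset.mem_filter, mem_monicsLT] at hp
    obtain ⟨⟨hpm, hp⟩, g, rfl⟩ := hp
    have hg : g.Monic := hmonic.of_mul_monic_left hp
    rw [hmonic.natDegree_mul hg] at hpm
    exact ⟨g, mem_monicsLT.2 ⟨by omega, hg⟩, rfl⟩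
  · intro g hg
    rw [mem_monicsLT] at hg
    rw [hmonic.natDegree_mul hg.2, Nat.sub_sub]

/-- The asymptotics of a scale-invariant weight over coprime pairs is determined by its asymptotics
over pairs not both divisible by `ℓ`. -/
lemma tendsto_sum_coprimePairs {ℓ : Fq[X]} (hmonic : ℓ.Monic) (hirr : Irreducible ℓ)
    {φ : Fq[X] × Fq[X] → ℝ} (hφ : ∀ g a b, ¬ ℓ ∣ g → φ (g * a, g * b) = φ (a, b)) {L : ℝ}
    (hL : Tendsto (fun m : ℕ => (∑ p ∈ primitivePairs ℓ m, φ p) / (Fintype.card Fq : ℝ) ^ (2 * m))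
      atTop (nhds L)) :
    Tendsto (fun m : ℕ => (∑ p ∈ coprimePairs Fq m, φ p) / (Fintype.card Fq : ℝ) ^ (2 * m)) atTop
      (nhds (L * (1 - (Fintype.card Fq : ℝ)⁻¹) /
        (1 - ((Fintype.card Fq : ℝ) ^ (2 * ℓ.natDegree))⁻¹))) := by
  have hn : 0 < ℓ.natDegree := hirr.natDegree_pos
  set n := ℓ.natDegree with hn_def
  have hq : (1 : ℝ) < Fintype.card Fq := by exact_mod_cast Fintype.one_lt_card
  set q : ℝ := (Fintype.card Fq : ℝ) with hq_def
  have hq0 : 0 < q := by linarith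
  set E : ℕ → ℝ := fun m => ∑ p ∈ coprimePairs Fq m, φ p with hE
  set P : ℕ → ℝ := fun m => ∑ p ∈ primitivePairs ℓ m, φ p with hP
  set S : ℕ → ℝ := fun m => ∑ g ∈ monicsLT Fq m, E (m - g.natDegree) with hS
  have hSsucc : ∀ m, S (m + 1) = E (m + 1) + q * S m := fun m => sum_monicsLT_succ E m
  have hPS : ∀ m, P (m + n) = S (m + n) - S m := by
    intro m
    have h1 := Finset.sum_filter_add_sum_filter_not (monicsLT Fq (m + n)) (fun g => ℓ ∣ g)
      (fun g => E (m + n - g.natDegree))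
    rw [sum_monicsLT_filter_dvd hmonic E (Nat.le_add_left _ _), Nat.add_sub_cancel] at h1
    have h2 := sum_primitivePairs hirr hφ (m + n)
    simp only [hP, hS, h2]
    linarith
  have hrec : ∀ j, E (j + 1 + n) = E (j + 1) + (P (j + 1 + n) - q * P (j + n)) := by
    intro j
    rw [hPS, hPS, hSsucc, show j + 1 + n = j + n + 1 by ring, hSsucc]
    ring
  refine tendsto_of_contracting_recurrence (n := n) hn
    (h := fun j => P (j + n) / q ^ (2 * (j + n)) -
      q⁻¹ * (P (j + n - 1) / q ^ (2 * (j + n - 1)))) (by positivity) ?_ ?_ ?_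
  · exact inv_lt_one_of_one_lt₀ (one_lt_pow₀ hq (by omega))
  · intro j hj
    obtain ⟨i, rfl⟩ := Nat.exists_eq_add_of_le' hj
    have := hrec i
    rw [show i + 1 + n - 1 = i + n by omega]
    simp only [hE] at this
    rw [this]
    rw [show 2 * (i + 1 + n) = 2 * i + 2 * n + 2 by ring, show 2 * (i + n) = 2 * i + 2 * n by ring,
      show 2 * (i + 1) = 2 * i + 2 by ring]
    simp only [pow_add]
    field_simp
  · have h1 := hL.comp (tendsto_add_atTop_nat n)
    have h2 := hL.comp (tendsto_add_atTop_nat (n - 1))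
    have h3 := h1.sub (h2.const_mul q⁻¹)
    rw [show L * (1 - q⁻¹) = L - q⁻¹ * L by ring]
    refine h3.congr fun j => ?_
    simp only [Function.comp_apply, Nat.add_sub_assoc hn]
    rfl

end Recurrence

section RootCounts

variable [Fintype Fq]

/-- The affine roots of `f` modulo `ℓ ^ k`. -/
noncomputable def affineRoots (f : Fq[X][X]) (ℓ : Fq[X]) (k : ℕ) : Finset Fq[X] :=
  (polysLT Fq (k * ℓ.natDegree)).filter (fun r => ℓ ^ k ∣ f.eval r)

/-- The projective roots of `f` modulo `ℓ ^ k`. -/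
noncomputable def projectiveRoots (f : Fq[X][X]) (ℓ : Fq[X]) (k : ℕ) : Finset Fq[X] :=
  (polysLT Fq (k * ℓ.natDegree)).filter (fun r => ℓ ∣ r ∧ ℓ ^ k ∣ homogEval f 1 r)

/-- The number of affine and projective roots of `f` modulo `ℓ ^ k`. -/
noncomputable def rootCount (f : Fq[X][X]) (ℓ : Fq[X]) (k : ℕ) : ℕ :=
  (affineRoots f ℓ k).card + (projectiveRoots f ℓ k).card

lemma exists_mem_polysLT_dvd_sub_mul {M a b : Fq[X]} (hM : M.Monic) (hb : IsCoprime M b) :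
    ∃ r ∈ polysLT Fq M.natDegree, M ∣ a - r * b := by
  obtain ⟨u, v, huv⟩ := hb
  refine ⟨(a * v) %ₘ M, ?_, u * a + (a * v) /ₘ M * b, ?_⟩
  · rw [mem_polysLT, ← degree_eq_natDegree hM.ne_zero]
    exact degree_modByMonic_lt _ hM
  · linear_combination (-a) * huv - b * modByMonic_add_div (a * v) M

lemma exists_rootCount_le {f : Fq[X][X]}
    (hsep : (f.map (algebraMap Fq[X] (RatFunc Fq))).Separable) {ℓ : Fq[X]} (hmonic : ℓ.Monic)
    (hirr : Irreducible ℓ) : ∃ B : ℕ, ∀ k, rootCount f ℓ k ≤ B := by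
  obtain ⟨u, v, c, hc, h⟩ := exists_bezout_of_separable hsep
  obtain ⟨B, hB⟩ := exists_card_roots_le hmonic hirr hc h
  have hsep' := separable_reverse hsep
  rw [reverse_map_of_injective (IsFractionRing.injective Fq[X] (RatFunc Fq))] at hsep'
  obtain ⟨u', v', c', hc', h'⟩ := exists_bezout_of_separable hsep'
  obtain ⟨B', hB'⟩ := exists_card_roots_le hmonic hirr hc' h'
  refine ⟨B + B', fun k => add_le_add (hB k) (le_trans (Finset.card_le_card fun r hr => ?_) (hB' k))⟩
  rw [projectiveRoots, Finset.mem_filter, homogEval_one_left] at hr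
  exact Finset.mem_filter.2 ⟨hr.1, hr.2.2⟩

/-- The number of primitive pairs at which the homogenization is divisible by `ℓ ^ k`. -/
lemma card_primitivePairs_filter_dvd (f : Fq[X][X]) {ℓ : Fq[X]} (hmonic : ℓ.Monic)
    (hirr : Irreducible ℓ) {m k : ℕ} (hk : 1 ≤ k) (hm : k * ℓ.natDegree ≤ m) :
    ((primitivePairs ℓ m).filter (fun p => ℓ ^ k ∣ homogEval f p.1 p.2)).card =
      (Fintype.card Fq ^ m - Fintype.card Fq ^ (m - ℓ.natDegree)) *
        (rootCount f ℓ k * Fintype.card Fq ^ (m - k * ℓ.natDegree)) := by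
  have hcop : ∀ {b : Fq[X]}, ¬ ℓ ∣ b → IsCoprime (ℓ ^ k) b := fun hb =>
    ((hirr.coprime_iff_not_dvd).2 hb).pow_left
  have hdeg : (ℓ ^ k).natDegree = k * ℓ.natDegree := hmonic.natDegree_pow k
  rw [rootCount, add_mul, mul_add,
    ← card_filter_ratio_mem hmonic hirr hk hm (affineRoots f ℓ k) (Finset.filter_subset _ _),
    ← card_filter_ratio_mem hmonic hirr hk hm (projectiveRoots f ℓ k) (Finset.filter_subset _ _),
    ← Finset.card_filter_add_card_filter_not (fun p : Fq[X] × Fq[X] => ¬ ℓ ∣ p.2)]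
  congr 1
  · congr 1
    ext ⟨a, b⟩
    simp only [primitivePairs, Finset.mem_filter, affineRoots]
    constructor
    · rintro ⟨⟨⟨hab, -⟩, hdvd⟩, hb⟩
      obtain ⟨r, hr, hrab⟩ := exists_mem_polysLT_dvd_sub_mul (a := a) (hmonic.pow k) (hcop hb)
      rw [hdeg] at hr
      exact ⟨hab, hb, r, ⟨hr, (dvd_homogEval_iff_left f hrab (hcop hb)).1 hdvd⟩, hrab⟩
    · rintro ⟨hab, hb, r, ⟨-, hr⟩, hrab⟩
      exact ⟨⟨⟨hab, fun h => hb h.2⟩, (dvd_homogEval_iff_left f hrab (hcop hb)).2 hr⟩, hb⟩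
  · rw [← Finset.card_map (Equiv.prodComm Fq[X] Fq[X]).toEmbedding]
    congr 1
    ext ⟨b, a⟩
    simp only [primitivePairs, Finset.mem_filter, projectiveRoots, Finset.mem_map_equiv,
      Equiv.prodComm_symm, Equiv.prodComm_apply, Prod.swap_prod_mk, Finset.mem_product, not_not]
    have hl : ∀ {r : Fq[X]}, ℓ ^ k ∣ b - r * a → ¬ ℓ ∣ a → (ℓ ∣ r ↔ ℓ ∣ b) := by
      intro r hr ha
      have hr' : ℓ ∣ b - r * a := (dvd_pow_self ℓ (by omega)).trans hr
      rw [← dvd_iff_dvd_of_dvd_sub (dvd_sub_comm.1 hr')]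
      exact ⟨fun h => h.mul_right _, fun h => (hirr.prime.dvd_or_dvd h).resolve_right ha⟩
    constructor
    · rintro ⟨⟨⟨⟨ha, hb⟩, hp⟩, hdvd⟩, hlb⟩
      have hla : ¬ ℓ ∣ a := fun h => hp ⟨h, hlb⟩
      obtain ⟨r, hr, hrab⟩ := exists_mem_polysLT_dvd_sub_mul (a := b) (hmonic.pow k) (hcop hla)
      rw [hdeg] at hr
      exact ⟨⟨hb, ha⟩, hla, r, ⟨hr, (hl hrab hla).2 hlb,
        (dvd_homogEval_iff_right f hrab (hcop hla)).1 hdvd⟩, hrab⟩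
    · rintro ⟨⟨hb, ha⟩, hla, r, ⟨-, hlr, hr⟩, hrab⟩
      exact ⟨⟨⟨⟨ha, hb⟩, fun h => hla h.1⟩, (dvd_homogEval_iff_right f hrab (hcop hla)).2 hr⟩,
        (hl hrab hla).1 hlr⟩

lemma card_primitivePairs {ℓ : Fq[X]} (hmonic : ℓ.Monic) {m : ℕ} (hm : ℓ.natDegree ≤ m) :
    (primitivePairs ℓ m).card + Fintype.card Fq ^ (2 * (m - ℓ.natDegree)) =
      Fintype.card Fq ^ (2 * m) := by
  have h1 := Finset.card_filter_add_card_filter_not (s := polysLT Fq m ×ˢ polysLT Fq m)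
    (fun p => ℓ ∣ p.1 ∧ ℓ ∣ p.2)
  have h2 : ((polysLT Fq m ×ˢ polysLT Fq m).filter (fun p => ℓ ∣ p.1 ∧ ℓ ∣ p.2)).card =
      Fintype.card Fq ^ (2 * (m - ℓ.natDegree)) := by
    have h3 := card_filter_modEq (Fq := Fq) hmonic hm 0
    simp only [sub_zero] at h3
    rw [Finset.filter_product (fun a => ℓ ∣ a) (fun a => ℓ ∣ a), Finset.card_product, h3]
    ring
  rw [Finset.card_product, card_polysLT, h2] at h1
  rw [primitivePairs, add_comm, h1]
  ring

end RootCounts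

section Averages

lemma sum_range_ite_pow_dvd {ℓ F : Fq[X]} (hirr : Irreducible ℓ) (hF : F ≠ 0) (K : ℕ) :
    ∑ k ∈ Finset.range K, (if ℓ ^ (k + 1) ∣ F then (1 : ℝ) else 0) =
      (min (multiplicity ℓ F) K : ℕ) := by
  have hfin : FiniteMultiplicity ℓ F := FiniteMultiplicity.of_prime_left hirr.prime hF
  rw [Finset.sum_boole, ← Finset.card_range (min (multiplicity ℓ F) K)]
  congr 2
  ext k
  simp only [Finset.mem_filter, Finset.mem_range, hfin.pow_dvd_iff_le_multiplicity]
  omega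

lemma multiplicity_mul_natDegree_le {ℓ F : Fq[X]} (hF : F ≠ 0) :
    multiplicity ℓ F * ℓ.natDegree ≤ F.natDegree := by
  rw [← natDegree_pow]
  exact natDegree_le_of_dvd (pow_multiplicity_dvd ℓ F) hF

/-- The `ℓ`-adic valuation of the homogenization, set to zero where the homogenization vanishes. -/
noncomputable def homogVal (f : Fq[X][X]) (ℓ : Fq[X]) (p : Fq[X] × Fq[X]) : ℝ :=
  if homogEval f p.1 p.2 ≠ 0 then (multiplicity ℓ (homogEval f p.1 p.2) : ℝ) else 0

lemma homogVal_mul (f : Fq[X][X]) {ℓ g : Fq[X]} (hirr : Irreducible ℓ) (hg : ¬ ℓ ∣ g)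
    (a b : Fq[X]) : homogVal f ℓ (g * a, g * b) = homogVal f ℓ (a, b) := by
  have hg0 : g ≠ 0 := fun h => hg (h ▸ dvd_zero ℓ)
  by_cases hF : homogEval f a b = 0
  · simp [homogVal, homogEval_mul, hF]
  have h1 : g ^ f.natDegree * homogEval f a b ≠ 0 := mul_ne_zero (pow_ne_zero _ hg0) hF
  rw [homogVal, homogVal, homogEval_mul, if_pos h1, if_pos hF,
    multiplicity_mul hirr.prime (FiniteMultiplicity.of_prime_left hirr.prime h1),
    multiplicity_eq_zero.2 fun h => hg (hirr.prime.dvd_of_dvd_pow h), zero_add]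

lemma le_homogVal {f : Fq[X][X]} {ℓ : Fq[X]} (hirr : Irreducible ℓ) (K : ℕ)
    (p : Fq[X] × Fq[X]) :
    ∑ k ∈ Finset.range K, (if ℓ ^ (k + 1) ∣ homogEval f p.1 p.2 then (1 : ℝ) else 0) -
      K * (if homogEval f p.1 p.2 = 0 then 1 else 0) ≤ homogVal f ℓ p := by
  rw [homogVal]
  by_cases hF : homogEval f p.1 p.2 = 0
  · simp [hF]
  · rw [sum_range_ite_pow_dvd hirr hF, if_neg hF, if_pos hF, mul_zero, sub_zero, Nat.cast_le]
    exact min_le_left _ _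

variable [Fintype Fq]

/-- The density of primitive pairs at which the homogenization is divisible by `ℓ ^ k`. -/
lemma card_primitivePairs_filter_dvd_div (f : Fq[X][X]) {ℓ : Fq[X]} (hmonic : ℓ.Monic)
    (hirr : Irreducible ℓ) {m k : ℕ} (hk : 1 ≤ k) (hm : k * ℓ.natDegree ≤ m) :
    (((primitivePairs ℓ m).filter (fun p => ℓ ^ k ∣ homogEval f p.1 p.2)).card : ℝ) /
        (Fintype.card Fq : ℝ) ^ (2 * m) =
      (1 - ((Fintype.card Fq : ℝ) ^ ℓ.natDegree)⁻¹) *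
        (rootCount f ℓ k * (((Fintype.card Fq : ℝ) ^ ℓ.natDegree) ^ k)⁻¹) := by
  have hq : (0 : ℝ) < Fintype.card Fq := by exact_mod_cast Fintype.card_pos
  have hnm : ℓ.natDegree ≤ m := le_trans (Nat.le_mul_of_pos_left _ hk) hm
  rw [card_primitivePairs_filter_dvd f hmonic hirr hk hm]
  push_cast [Nat.cast_sub (Nat.pow_le_pow_right Fintype.card_pos (Nat.sub_le m ℓ.natDegree))]
  rw [pow_sub₀ _ hq.ne' hnm, pow_sub₀ _ hq.ne' hm, ← pow_mul, mul_comm ℓ.natDegree k, two_mul,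
    pow_add]
  field_simp

lemma sum_primitivePairs_ite_pow_dvd (f : Fq[X][X]) {ℓ : Fq[X]} (hmonic : ℓ.Monic)
    (hirr : Irreducible ℓ) {m K : ℕ} (hm : K * ℓ.natDegree ≤ m) :
    (∑ p ∈ primitivePairs ℓ m, ∑ k ∈ Finset.range K,
        (if ℓ ^ (k + 1) ∣ homogEval f p.1 p.2 then (1 : ℝ) else 0)) /
          (Fintype.card Fq : ℝ) ^ (2 * m) =
      (1 - ((Fintype.card Fq : ℝ) ^ ℓ.natDegree)⁻¹) * ∑ k ∈ Finset.range K,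
        (rootCount f ℓ (k + 1) * (((Fintype.card Fq : ℝ) ^ ℓ.natDegree) ^ (k + 1))⁻¹) := by
  rw [Finset.sum_comm, Finset.sum_div, Finset.mul_sum]
  refine Finset.sum_congr rfl fun k hk => ?_
  rw [Finset.sum_boole, card_primitivePairs_filter_dvd_div f hmonic hirr (Nat.le_add_left 1 k)]
  exact le_trans (Nat.mul_le_mul_right _ (Finset.mem_range.1 hk)) hm

lemma homogVal_le {f : Fq[X][X]} {ℓ : Fq[X]} (hirr : Irreducible ℓ) {m : ℕ} (K : ℕ)
    {p : Fq[X] × Fq[X]} (hp : p ∈ primitivePairs ℓ m) :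
    homogVal f ℓ p ≤ ∑ k ∈ Finset.range K,
      (if ℓ ^ (k + 1) ∣ homogEval f p.1 p.2 then (1 : ℝ) else 0) +
      (f.natDegree * m + (Finset.range (f.natDegree + 1)).sup (fun i => (f.coeff i).natDegree) : ℕ) *
        (if ℓ ^ K ∣ homogEval f p.1 p.2 then 1 else 0) := by
  simp only [primitivePairs, Finset.mem_filter, Finset.mem_product, mem_polysLT] at hp
  obtain ⟨⟨ha, hb⟩, -⟩ := hp
  rw [homogVal]
  split_ifs with hF hdvd hdvd
  · rw [sum_range_ite_pow_dvd hirr hF, mul_one, ← Nat.cast_add, Nat.cast_le]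
    have h1 := multiplicity_mul_natDegree_le (ℓ := ℓ) hF
    have h2 := natDegree_homogEval_le f (natDegree_le_of_degree_le ha.le)
      (natDegree_le_of_degree_le hb.le)
    have h3 := Nat.le_mul_of_pos_right (multiplicity ℓ (homogEval f p.1 p.2)) hirr.natDegree_pos
    omega
  · rw [sum_range_ite_pow_dvd hirr hF, mul_zero, add_zero, Nat.cast_le]
    rw [(FiniteMultiplicity.of_prime_left hirr.prime hF).pow_dvd_iff_le_multiplicity] at hdvd
    omega
  · positivity
  · positivity

lemma card_primitivePairs_filter_eq_zero_div_le {f : Fq[X][X]} (hf : f ≠ 0) (ℓ : Fq[X]) (m : ℕ) :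
    (((primitivePairs ℓ m).filter (fun p => homogEval f p.1 p.2 = 0)).card : ℝ) /
      (Fintype.card Fq : ℝ) ^ (2 * m) ≤ f.natDegree * ((Fintype.card Fq : ℝ)⁻¹) ^ m := by
  have hq : (0 : ℝ) < Fintype.card Fq := by exact_mod_cast Fintype.card_pos
  have h1 := (Finset.card_le_card (Finset.filter_subset_filter
    (fun p : Fq[X] × Fq[X] => homogEval f p.1 p.2 = 0) (Finset.filter_subset
      (fun p : Fq[X] × Fq[X] => ¬ (ℓ ∣ p.1 ∧ ℓ ∣ p.2)) (polysLT Fq m ×ˢ polysLT Fq m)))).trans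
    (card_filter_homogEval_eq_zero_le hf m)
  have h2 : (((primitivePairs ℓ m).filter (fun p => homogEval f p.1 p.2 = 0)).card : ℝ) ≤
      f.natDegree * (Fintype.card Fq : ℝ) ^ m := by exact_mod_cast h1
  rw [div_le_iff₀ (by positivity)]
  refine h2.trans_eq ?_
  rw [two_mul, pow_add, inv_pow]
  field_simp

lemma tendsto_inv_card_pow : Tendsto (fun m : ℕ => ((Fintype.card Fq : ℝ)⁻¹) ^ m) atTop (nhds 0) :=
  tendsto_pow_atTop_nhds_zero_of_lt_one (by positivity)
    (inv_lt_one_of_one_lt₀ (by exact_mod_cast Fintype.one_lt_card))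

lemma tendsto_mul_inv_card_pow :
    Tendsto (fun m : ℕ => (m : ℝ) * ((Fintype.card Fq : ℝ)⁻¹) ^ m) atTop (nhds 0) :=
  tendsto_self_mul_const_pow_of_lt_one (by positivity)
    (inv_lt_one_of_one_lt₀ (by exact_mod_cast Fintype.one_lt_card))

lemma summable_rootCount {f : Fq[X][X]}
    (hsep : (f.map (algebraMap Fq[X] (RatFunc Fq))).Separable) {ℓ : Fq[X]} (hmonic : ℓ.Monic)
    (hirr : Irreducible ℓ) :
    Summable (fun k : ℕ =>
      (rootCount f ℓ k : ℝ) * (((Fintype.card Fq : ℝ) ^ ℓ.natDegree) ^ k)⁻¹) := by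
  obtain ⟨B, hB⟩ := exists_rootCount_le hsep hmonic hirr
  have hQ : (1 : ℝ) < (Fintype.card Fq : ℝ) ^ ℓ.natDegree :=
    one_lt_pow₀ (by exact_mod_cast Fintype.one_lt_card) hirr.natDegree_pos.ne'
  refine Summable.of_nonneg_of_le (fun k => by positivity) (fun k => ?_)
    ((summable_geometric_of_lt_one (by positivity) (inv_lt_one_of_one_lt₀ hQ)).mul_left (B : ℝ))
  rw [inv_pow]
  gcongr
  exact hB k

lemma tendsto_sum_primitivePairs_homogVal {f : Fq[X][X]} (hf : f ≠ 0)
    (hsep : (f.map (algebraMap Fq[X] (RatFunc Fq))).Separable) {ℓ : Fq[X]} (hmonic : ℓ.Monic)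
    (hirr : Irreducible ℓ) :
    Tendsto (fun m : ℕ => (∑ p ∈ primitivePairs ℓ m, homogVal f ℓ p) /
        (Fintype.card Fq : ℝ) ^ (2 * m)) atTop
      (nhds ((1 - ((Fintype.card Fq : ℝ) ^ ℓ.natDegree)⁻¹) * ∑' k : ℕ,
        (rootCount f ℓ (k + 1) * (((Fintype.card Fq : ℝ) ^ ℓ.natDegree) ^ (k + 1))⁻¹))) := by
  obtain ⟨B, hB⟩ := exists_rootCount_le hsep hmonic hirr
  have hn : 0 < ℓ.natDegree := hirr.natDegree_pos
  have hq1 : (1 : ℝ) < Fintype.card Fq := by exact_mod_cast Fintype.one_lt_card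
  have hQ : (1 : ℝ) < (Fintype.card Fq : ℝ) ^ ℓ.natDegree := one_lt_pow₀ hq1 hn.ne'
  have hq : (0 : ℝ) < Fintype.card Fq := by linarith
  have hmain := ((((summable_nat_add_iff 1).2
    (summable_rootCount hsep hmonic hirr)).tendsto_sum_tsum_nat).comp
      (Nat.tendsto_div_const_atTop hn.ne')).const_mul
        (1 - ((Fintype.card Fq : ℝ) ^ ℓ.natDegree)⁻¹)
  have hlow := hmain.sub ((tendsto_mul_inv_card_pow (Fq := Fq)).const_mul (f.natDegree : ℝ))
  set C : ℕ := (Finset.range (f.natDegree + 1)).sup (fun i => (f.coeff i).natDegree) with hC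
  have hupp := hmain.add ((((tendsto_mul_inv_card_pow (Fq := Fq)).const_mul (f.natDegree : ℝ)).add
    ((tendsto_inv_card_pow (Fq := Fq)).const_mul (C : ℝ))).const_mul
      (B * (Fintype.card Fq : ℝ) ^ ℓ.natDegree))
  simp only [mul_zero, sub_zero, add_zero] at hlow hupp
  refine tendsto_of_tendsto_of_tendsto_of_le_of_le' hlow hupp ?_ ?_
  · filter_upwards with m
    have h1 := Finset.sum_le_sum fun p (_ : p ∈ primitivePairs ℓ m) =>
      le_homogVal (f := f) hirr (m / ℓ.natDegree) p
    rw [Finset.sum_sub_distrib, ← Finset.mul_sum, Finset.sum_boole] at h1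
    have h2 := div_le_div_of_nonneg_right h1 (pow_nonneg hq.le (2 * m))
    rw [sub_div, sum_primitivePairs_ite_pow_dvd f hmonic hirr (Nat.div_mul_le_self _ _),
      mul_div_assoc] at h2
    refine le_trans (sub_le_sub_left ?_ _) h2
    have h3 := card_primitivePairs_filter_eq_zero_div_le hf ℓ m
    have h4 : ((m / ℓ.natDegree : ℕ) : ℝ) ≤ m := by exact_mod_cast Nat.div_le_self _ _
    calc _ ≤ (m : ℝ) * (f.natDegree * ((Fintype.card Fq : ℝ)⁻¹) ^ m) :=
          mul_le_mul h4 h3 (by positivity) (by positivity)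
      _ = _ := by ring
  · filter_upwards [eventually_ge_atTop ℓ.natDegree] with m hm
    have h1 := Finset.sum_le_sum fun p (hp : p ∈ primitivePairs ℓ m) =>
      homogVal_le (f := f) hirr (m / ℓ.natDegree) hp
    rw [Finset.sum_add_distrib, ← Finset.mul_sum, Finset.sum_boole] at h1
    have h2 := div_le_div_of_nonneg_right h1 (pow_nonneg hq.le (2 * m))
    rw [add_div, sum_primitivePairs_ite_pow_dvd f hmonic hirr (Nat.div_mul_le_self _ _),
      mul_div_assoc, card_primitivePairs_filter_dvd_div f hmonic hirr
        ((Nat.one_le_div_iff hn).2 hm) (Nat.div_mul_le_self _ _), ← hC] at h2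
    refine h2.trans (add_le_add_right ?_ _)
    have h3 : (((Fintype.card Fq : ℝ) ^ ℓ.natDegree) ^ (m / ℓ.natDegree))⁻¹ ≤
        (Fintype.card Fq : ℝ) ^ ℓ.natDegree * ((Fintype.card Fq : ℝ)⁻¹) ^ m := by
      rw [inv_pow, ← div_eq_mul_inv, inv_le_comm₀ (by positivity) (by positivity), inv_div,
        div_le_iff₀ (by positivity), ← pow_mul, ← pow_add]
      refine pow_le_pow_right₀ hq1.le ?_
      have := Nat.div_add_mod m ℓ.natDegree
      have := Nat.mod_lt m hn
      omega
    have h4 : 1 - ((Fintype.card Fq : ℝ) ^ ℓ.natDegree)⁻¹ ≤ 1 := by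
      have : 0 ≤ ((Fintype.card Fq : ℝ) ^ ℓ.natDegree)⁻¹ := by positivity
      linarith
    have h5 : (rootCount f ℓ (m / ℓ.natDegree) : ℝ) ≤ B := by exact_mod_cast hB _
    have h6 : (1 - ((Fintype.card Fq : ℝ) ^ ℓ.natDegree)⁻¹) *
        (rootCount f ℓ (m / ℓ.natDegree) *
          (((Fintype.card Fq : ℝ) ^ ℓ.natDegree) ^ (m / ℓ.natDegree))⁻¹) ≤
        1 * (B * ((Fintype.card Fq : ℝ) ^ ℓ.natDegree * ((Fintype.card Fq : ℝ)⁻¹) ^ m)) :=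
      mul_le_mul h4 (mul_le_mul h5 h3 (by positivity) (by positivity)) (by positivity) zero_le_one
    calc _ ≤ ((f.natDegree * m + C : ℕ) : ℝ) *
          (1 * (B * ((Fintype.card Fq : ℝ) ^ ℓ.natDegree * ((Fintype.card Fq : ℝ)⁻¹) ^ m))) :=
          mul_le_mul_of_nonneg_left h6 (by positivity)
      _ = _ := by push_cast; ring

lemma tendsto_card_primitivePairs {f : Fq[X][X]} (hf : f ≠ 0) {ℓ : Fq[X]} (hmonic : ℓ.Monic) :
    Tendsto (fun m : ℕ => (∑ p ∈ primitivePairs ℓ m,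
        (if homogEval f p.1 p.2 ≠ 0 then (1 : ℝ) else 0)) /
        (Fintype.card Fq : ℝ) ^ (2 * m)) atTop
      (nhds (1 - ((Fintype.card Fq : ℝ) ^ (2 * ℓ.natDegree))⁻¹)) := by
  have hq : (0 : ℝ) < Fintype.card Fq := by exact_mod_cast Fintype.card_pos
  have hz : Tendsto (fun m : ℕ =>
      (((primitivePairs ℓ m).filter (fun p => homogEval f p.1 p.2 = 0)).card : ℝ) /
        (Fintype.card Fq : ℝ) ^ (2 * m)) atTop (nhds 0) :=
    squeeze_zero (fun m => by positivity) (card_primitivePairs_filter_eq_zero_div_le hf ℓ)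
      (by simpa using (tendsto_inv_card_pow (Fq := Fq)).const_mul (f.natDegree : ℝ))
  have h1 := hz.const_sub (1 - ((Fintype.card Fq : ℝ) ^ (2 * ℓ.natDegree))⁻¹)
  rw [sub_zero] at h1
  refine h1.congr' ?_
  filter_upwards [eventually_ge_atTop ℓ.natDegree] with m hm
  have h2 := card_primitivePairs hmonic hm
  have h3 := Finset.card_filter_add_card_filter_not (s := primitivePairs ℓ m)
    (fun p => homogEval f p.1 p.2 = 0)
  rw [← h3] at h2
  have h4 : (Fintype.card Fq : ℝ) ^ (2 * m) = (Fintype.card Fq : ℝ) ^ (2 * (m - ℓ.natDegree)) *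
      (Fintype.card Fq : ℝ) ^ (2 * ℓ.natDegree) := by
    rw [← pow_add]
    congr 1
    omega
  have h5 : ((Fintype.card Fq : ℝ) ^ (2 * ℓ.natDegree))⁻¹ =
      (Fintype.card Fq : ℝ) ^ (2 * (m - ℓ.natDegree)) / (Fintype.card Fq : ℝ) ^ (2 * m) := by
    rw [h4]
    field_simp
  have h6 : (1 : ℝ) = (Fintype.card Fq : ℝ) ^ (2 * m) / (Fintype.card Fq : ℝ) ^ (2 * m) :=
    (div_self (by positivity)).symm
  rw [Finset.sum_boole, h5, eq_div_iff (by positivity)]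
  have h7 : (Fintype.card Fq : ℝ) ^ (2 * m) ≠ 0 := by positivity
  field_simp
  have h8 := congrArg (Nat.cast : ℕ → ℝ) h2
  push_cast at h8
  simp only [ne_eq]
  linarith

/-- The average valuation of the homogenization over coprime pairs. -/
lemma tendsto_average_homogVal {f : Fq[X][X]} (hf : f ≠ 0)
    (hsep : (f.map (algebraMap Fq[X] (RatFunc Fq))).Separable) {ℓ : Fq[X]} (hmonic : ℓ.Monic)
    (hirr : Irreducible ℓ) :
    Tendsto (fun m : ℕ => (∑ p ∈ coprimePairs Fq m, homogVal f ℓ p) /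
        ∑ p ∈ coprimePairs Fq m, (if homogEval f p.1 p.2 ≠ 0 then (1 : ℝ) else 0)) atTop
      (nhds ((Fintype.card Fq : ℝ) ^ ℓ.natDegree / ((Fintype.card Fq : ℝ) ^ ℓ.natDegree + 1) *
        ∑' k : ℕ,
          (rootCount f ℓ (k + 1) * (((Fintype.card Fq : ℝ) ^ ℓ.natDegree) ^ (k + 1))⁻¹))) := by
  have hq1 : (1 : ℝ) < Fintype.card Fq := by exact_mod_cast Fintype.one_lt_card
  have hQ : (1 : ℝ) < (Fintype.card Fq : ℝ) ^ ℓ.natDegree :=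
    one_lt_pow₀ hq1 hirr.natDegree_pos.ne'
  have h1 := tendsto_sum_coprimePairs hmonic hirr
    (fun g a b hg => homogVal_mul f hirr hg a b)
    (tendsto_sum_primitivePairs_homogVal hf hsep hmonic hirr)
  have h2 := tendsto_sum_coprimePairs hmonic hirr
    (φ := fun p => if homogEval f p.1 p.2 ≠ 0 then (1 : ℝ) else 0)
    (fun g a b hg => by
      have hg0 : g ≠ 0 := fun h => hg (h ▸ dvd_zero ℓ)
      simp [homogEval_mul, hg0])
    (tendsto_card_primitivePairs hf hmonic)
  have hQ2 : 1 - ((Fintype.card Fq : ℝ) ^ (2 * ℓ.natDegree))⁻¹ =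
      (1 - ((Fintype.card Fq : ℝ) ^ ℓ.natDegree)⁻¹) *
        (((Fintype.card Fq : ℝ) ^ ℓ.natDegree + 1) / (Fintype.card Fq : ℝ) ^ ℓ.natDegree) := by
    rw [two_mul, pow_add]
    field_simp
    ring
  have hQ3 : 0 < 1 - ((Fintype.card Fq : ℝ) ^ ℓ.natDegree)⁻¹ :=
    sub_pos.2 (inv_lt_one_of_one_lt₀ hQ)
  have hq3 : 0 < 1 - (Fintype.card Fq : ℝ)⁻¹ := sub_pos.2 (inv_lt_one_of_one_lt₀ hq1)
  have hq4 : 0 < 1 - ((Fintype.card Fq : ℝ) ^ (2 * ℓ.natDegree))⁻¹ := by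
    rw [hQ2]
    positivity
  have h3 := h1.div h2 (by positivity)
  convert h3 using 1
  · ext m
    have : (Fintype.card Fq : ℝ) ^ (2 * m) ≠ 0 := by positivity
    exact (div_div_div_cancel_right₀ this _ _).symm
  · congr 1
    rw [mul_div_assoc, mul_div_assoc (1 - ((Fintype.card Fq : ℝ) ^ (2 * ℓ.natDegree))⁻¹),
      mul_div_mul_right _ _ (by positivity), hQ2]
    generalize 1 - ((Fintype.card Fq : ℝ) ^ ℓ.natDegree)⁻¹ = x at hQ3 ⊢
    field_simp

lemma sum_multiplicity_eq {ℓ : Fq[X]} (hmonic : ℓ.Monic) (hirr : Irreducible ℓ) (m : ℕ) :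
    ∑ P ∈ (polysLT Fq m).filter (fun P => P ≠ 0), (multiplicity ℓ P : ℝ) =
      ∑ k ∈ Finset.range (m / ℓ.natDegree),
        ((Fintype.card Fq : ℝ) ^ (m - (k + 1) * ℓ.natDegree) - 1) := by
  have hn : 0 < ℓ.natDegree := hirr.natDegree_pos
  have h1 : ∀ P ∈ (polysLT Fq m).filter (fun P => P ≠ 0), (multiplicity ℓ P : ℝ) =
      ∑ k ∈ Finset.range (m / ℓ.natDegree), (if ℓ ^ (k + 1) ∣ P then (1 : ℝ) else 0) := by
    intro P hP
    rw [Finset.mem_filter, mem_polysLT] at hP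
    have h2 := (natDegree_lt_iff_degree_lt hP.2).2 hP.1
    have h3 := multiplicity_mul_natDegree_le (ℓ := ℓ) hP.2
    rw [sum_range_ite_pow_dvd hirr hP.2, min_eq_left]
    rw [Nat.le_div_iff_mul_le hn]
    omega
  rw [Finset.sum_congr rfl h1, Finset.sum_comm]
  refine Finset.sum_congr rfl fun k hk => ?_
  have hkm : (k + 1) * ℓ.natDegree ≤ m :=
    (Nat.le_div_iff_mul_le hn).1 (Finset.mem_range.1 hk)
  have h4 := card_filter_modEq (Fq := Fq) (m := m) (hmonic.pow (k + 1))
    (by rw [hmonic.natDegree_pow]; exact hkm) 0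
  rw [hmonic.natDegree_pow] at h4
  simp only [sub_zero] at h4
  have h5 : (0 : Fq[X]) ∈ (polysLT Fq m).filter (fun P => ℓ ^ (k + 1) ∣ P) := by
    rw [Finset.mem_filter, mem_polysLT]
    simp
  rw [Finset.sum_boole, Finset.filter_filter]
  have h6 : (polysLT Fq m).filter (fun P => P ≠ 0 ∧ ℓ ^ (k + 1) ∣ P) =
      ((polysLT Fq m).filter (fun P => ℓ ^ (k + 1) ∣ P)).erase 0 := by
    ext P
    simp only [Finset.mem_filter, Finset.mem_erase]
    tauto
  rw [h6, Finset.cast_card_erase_of_mem h5, h4, Nat.cast_pow]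

/-- The average valuation of a nonzero polynomial. -/
lemma tendsto_average_multiplicity {ℓ : Fq[X]} (hmonic : ℓ.Monic) (hirr : Irreducible ℓ) :
    Tendsto (fun m : ℕ => (∑ P ∈ (polysLT Fq m).filter (fun P => P ≠ 0), (multiplicity ℓ P : ℝ)) /
        (((polysLT Fq m).filter (fun P => P ≠ 0)).card : ℝ)) atTop
      (nhds (1 / ((Fintype.card Fq : ℝ) ^ ℓ.natDegree - 1))) := by
  have hn : 0 < ℓ.natDegree := hirr.natDegree_pos
  have hq1 : (1 : ℝ) < Fintype.card Fq := by exact_mod_cast Fintype.one_lt_card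
  have hQ : (1 : ℝ) < (Fintype.card Fq : ℝ) ^ ℓ.natDegree := one_lt_pow₀ hq1 hn.ne'
  have hq : (0 : ℝ) < Fintype.card Fq := by linarith
  have hcard : ∀ m, (((polysLT Fq m).filter (fun P => P ≠ 0)).card : ℝ) =
      (Fintype.card Fq : ℝ) ^ m - 1 := by
    intro m
    have h0 : (0 : Fq[X]) ∈ polysLT Fq m := by
      rw [mem_polysLT]
      simp
    rw [Finset.filter_ne', Finset.cast_card_erase_of_mem h0, card_polysLT, Nat.cast_pow]
  have hgeom := (((hasSum_geometric_of_lt_one (by positivity)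
    (inv_lt_one_of_one_lt₀ hQ)).mul_right ((Fintype.card Fq : ℝ) ^ ℓ.natDegree)⁻¹).tendsto_sum_nat).comp
      (Nat.tendsto_div_const_atTop hn.ne')
  have herr : Tendsto (fun m : ℕ => ((m / ℓ.natDegree : ℕ) : ℝ) * ((Fintype.card Fq : ℝ)⁻¹) ^ m)
      atTop (nhds 0) := by
    refine squeeze_zero (fun m => by positivity) (fun m => ?_) (tendsto_mul_inv_card_pow (Fq := Fq))
    gcongr
    exact Nat.div_le_self _ _
  have h1 := (hgeom.sub herr).div ((tendsto_inv_card_pow (Fq := Fq)).const_sub 1) (by simp)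
  have hlim : 1 / ((Fintype.card Fq : ℝ) ^ ℓ.natDegree - 1) =
      ((1 - ((Fintype.card Fq : ℝ) ^ ℓ.natDegree)⁻¹)⁻¹ *
        ((Fintype.card Fq : ℝ) ^ ℓ.natDegree)⁻¹ - 0) / (1 - 0) := by
    rw [sub_zero, sub_zero, div_one, ← mul_inv, sub_mul, inv_mul_cancel₀ (by positivity), one_mul,
      one_div]
  rw [hlim]
  refine h1.congr fun m => ?_
  simp only [Pi.div_apply, Function.comp_apply]
  rw [sum_multiplicity_eq hmonic hirr, hcard, Finset.sum_sub_distrib, Finset.sum_const,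
    Finset.card_range, nsmul_one]
  have h2 : ∑ k ∈ Finset.range (m / ℓ.natDegree),
      (Fintype.card Fq : ℝ) ^ (m - (k + 1) * ℓ.natDegree) =
      (Fintype.card Fq : ℝ) ^ m * ∑ k ∈ Finset.range (m / ℓ.natDegree),
        (((Fintype.card Fq : ℝ) ^ ℓ.natDegree)⁻¹ ^ k * ((Fintype.card Fq : ℝ) ^ ℓ.natDegree)⁻¹) := by
    rw [Finset.mul_sum]
    refine Finset.sum_congr rfl fun k hk => ?_
    have hkm : (k + 1) * ℓ.natDegree ≤ m :=
      (Nat.le_div_iff_mul_le hn).1 (Finset.mem_range.1 hk)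
    rw [pow_sub₀ _ hq.ne' hkm, ← pow_succ, inv_pow, ← pow_mul, mul_comm ℓ.natDegree]
  rw [h2, inv_pow]
  have h3 : (Fintype.card Fq : ℝ) ^ m ≠ 0 := by positivity
  rw [← mul_div_mul_left _ _ h3]
  congr 1 <;> field_simp

end Averages

section Series

variable [Fintype Fq]

/-- The tagged affine and projective roots of `f` modulo `ℓ ^ k`. -/
noncomputable def taggedRoots (f : Fq[X][X]) (ℓ : Fq[X]) (k : ℕ) : Finset (Bool × Fq[X]) :=
  ({true} ×ˢ affineRoots f ℓ k) ∪ ({false} ×ˢ projectiveRoots f ℓ k)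

lemma card_taggedRoots (f : Fq[X][X]) (ℓ : Fq[X]) (k : ℕ) :
    (taggedRoots f ℓ k).card = rootCount f ℓ k := by
  rw [taggedRoots, Finset.card_union_of_disjoint, Finset.card_product, Finset.card_product,
    rootCount]
  · simp
  · rw [Finset.disjoint_left]
    simp +contextual

lemma mem_rootPairs_iff {f : Fq[X][X]} {ℓ : Fq[X]} {s : Bool} {r : Fq[X]} {k : ℕ} :
    (s, r, k) ∈ rootPairs f ℓ ↔ 1 ≤ k ∧ (s, r) ∈ taggedRoots f ℓ k := by
  simp only [rootPairs, Set.mem_ofPred_eq, taggedRoots, affineRoots, projectiveRoots,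
    Finset.mem_union, Finset.mem_product, Finset.mem_singleton, Finset.mem_filter, mem_polysLT]
  tauto

/-- The root pairs, fibred over the exponent. -/
noncomputable def sigmaTaggedRootsEquiv (f : Fq[X][X]) (ℓ : Fq[X]) :
    (Σ k : ℕ, taggedRoots f ℓ (k + 1)) ≃ rootPairs f ℓ :=
  Equiv.ofBijective
    (fun x => ⟨(x.2.1.1, x.2.1.2, x.1 + 1), mem_rootPairs_iff.2 ⟨Nat.le_add_left _ _, x.2.2⟩⟩) <| by
  constructor
  · rintro ⟨k, ⟨⟨s, r⟩, h⟩⟩ ⟨k', ⟨⟨s', r'⟩, h'⟩⟩ heq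
    simp only [Subtype.mk.injEq, Prod.mk.injEq, add_left_inj] at heq
    obtain ⟨rfl, rfl, rfl⟩ := heq
    rfl
  · rintro ⟨⟨s, r, k⟩, h⟩
    obtain ⟨hk, hr⟩ := mem_rootPairs_iff.1 h
    obtain ⟨j, rfl⟩ := Nat.exists_eq_add_of_le' hk
    exact ⟨⟨j, ⟨(s, r), hr⟩⟩, rfl⟩

lemma summable_sigma_taggedRoots {f : Fq[X][X]} {ℓ : Fq[X]} {w : ℕ → ℝ} (hw : ∀ k, 0 ≤ w k)
    (hs : Summable fun k => (rootCount f ℓ k : ℝ) * w k) :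
    Summable fun x : Σ k : ℕ, taggedRoots f ℓ (k + 1) => w (x.1 + 1) := by
  rw [summable_sigma_of_nonneg fun x => hw _]
  refine ⟨fun k => Summable.of_finite, ?_⟩
  simpa [tsum_fintype, card_taggedRoots] using (summable_nat_add_iff 1).2 hs

lemma summable_rootPairs {f : Fq[X][X]} {ℓ : Fq[X]} {w : ℕ → ℝ} (hw : ∀ k, 0 ≤ w k)
    (hs : Summable fun k => (rootCount f ℓ k : ℝ) * w k) :
    Summable fun x : rootPairs f ℓ => w (x : Bool × Fq[X] × ℕ).2.2 :=
  (sigmaTaggedRootsEquiv f ℓ).summable_iff.1 (summable_sigma_taggedRoots hw hs)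

lemma tsum_rootPairs {f : Fq[X][X]} {ℓ : Fq[X]} {w : ℕ → ℝ} (hw : ∀ k, 0 ≤ w k)
    (hs : Summable fun k => (rootCount f ℓ k : ℝ) * w k) :
    ∑' x : rootPairs f ℓ, w (x : Bool × Fq[X] × ℕ).2.2 =
      ∑' k, (rootCount f ℓ (k + 1) : ℝ) * w (k + 1) := by
  rw [← (sigmaTaggedRootsEquiv f ℓ).tsum_eq]
  refine ((summable_sigma_taggedRoots hw hs).tsum_sigma).trans (tsum_congr fun k => ?_)
  simp [tsum_fintype, card_taggedRoots]

end Series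

end

end AlphaEll

/-- (Proposition `ca` of the paper.)  Let `f ∈ F_q[t][x]` with
`deg_x f = d ≥ 1`, squarefree/separable as a polynomial in `x` over `F_q(t)`
(`gcd(f, ∂f/∂x) = 1`), and `ℓ` monic irreducible not dividing all coefficients of `f`.
Then the series `Σ_{(r,k) ∈ S(f,ℓ)} Norm(ℓ)^{-k}` converges, the two averages defining
`α_ℓ(f)` exist, and
`α_ℓ(f) = deg ℓ ( 1/(Norm(ℓ)-1) - Norm(ℓ)/(Norm(ℓ)+1) Σ_{(r,k) ∈ S(f,ℓ)} Norm(ℓ)^{-k} )`. -/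
theorem alpha_ell_exists_and_formula
    (Fq : Type*) [Field Fq] [Fintype Fq]
    (f : Polynomial (Polynomial Fq)) (d : ℕ) (hd : f.natDegree = d) (hd1 : 1 ≤ d)
    (hsep : (f.map (algebraMap (Polynomial Fq) (RatFunc Fq))).Separable)
    (ℓ : Polynomial Fq) (hmonic : ℓ.Monic) (hirr : Irreducible ℓ)
    (hcont : ∃ i, ¬ ℓ ∣ f.coeff i) :
    Summable (fun x : rootPairs f ℓ =>
      (((Fintype.card Fq : ℝ) ^ ℓ.natDegree) ^ ((x : Bool × Polynomial Fq × ℕ).2.2))⁻¹) ∧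
    ∃ A₁ A₂ : ℝ,
      Filter.Tendsto (fun N : ℕ =>
          (∑ᶠ P ∈ {P : Polynomial Fq | P ≠ 0 ∧ P.degree ≤ (N : WithBot ℕ)},
            (multiplicity ℓ P : ℝ)) /
          (({P : Polynomial Fq | P ≠ 0 ∧ P.degree ≤ (N : WithBot ℕ)}).ncard : ℝ))
        Filter.atTop (nhds A₁) ∧
      Filter.Tendsto (fun N : ℕ =>
          (∑ᶠ ab ∈ {ab : Polynomial Fq × Polynomial Fq | IsCoprime ab.1 ab.2 ∧
              homogEval f ab.1 ab.2 ≠ 0 ∧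
              ab.1.degree ≤ (N : WithBot ℕ) ∧ ab.2.degree ≤ (N : WithBot ℕ)},
            (multiplicity ℓ (homogEval f ab.1 ab.2) : ℝ)) /
          (({ab : Polynomial Fq × Polynomial Fq | IsCoprime ab.1 ab.2 ∧
              homogEval f ab.1 ab.2 ≠ 0 ∧
              ab.1.degree ≤ (N : WithBot ℕ) ∧ ab.2.degree ≤ (N : WithBot ℕ)}).ncard : ℝ))
        Filter.atTop (nhds A₂) ∧
      (ℓ.natDegree : ℝ) * (A₁ - A₂) =
        (ℓ.natDegree : ℝ) * (1 / ((Fintype.card Fq : ℝ) ^ ℓ.natDegree - 1) -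
          ((Fintype.card Fq : ℝ) ^ ℓ.natDegree / ((Fintype.card Fq : ℝ) ^ ℓ.natDegree + 1)) *
            ∑' x : rootPairs f ℓ,
              (((Fintype.card Fq : ℝ) ^ ℓ.natDegree) ^ ((x : Bool × Polynomial Fq × ℕ).2.2))⁻¹) := by
  classical
  have hf : f ≠ 0 := by
    rintro rfl
    simp at hd
    omega
  have hw : ∀ k : ℕ, 0 ≤ (((Fintype.card Fq : ℝ) ^ ℓ.natDegree) ^ k)⁻¹ := fun k => by positivity
  have hs := AlphaEll.summable_rootCount hsep hmonic hirr
  have hdeg : ∀ (P : Fq[X]) (N : ℕ),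
      P.degree ≤ (N : WithBot ℕ) ↔ P ∈ AlphaEll.polysLT Fq (N + 1) := fun P N => by
    rw [AlphaEll.mem_polysLT, degree_le_iff_coeff_zero, degree_lt_iff_coeff_zero]
    simp
  refine ⟨AlphaEll.summable_rootPairs hw hs, _, _,
    ((AlphaEll.tendsto_average_multiplicity hmonic hirr).comp (tendsto_add_atTop_nat 1)).congr
      fun N => ?_,
    ((AlphaEll.tendsto_average_homogVal hf hsep hmonic hirr).comp (tendsto_add_atTop_nat 1)).congr
      fun N => ?_, ?_⟩
  · have hset : {P : Fq[X] | P ≠ 0 ∧ P.degree ≤ (N : WithBot ℕ)} =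
        ((AlphaEll.polysLT Fq (N + 1)).filter (fun P => P ≠ 0) : Finset Fq[X]) := by
      ext P
      simp [hdeg, and_comm]
    rw [hset, Set.ncard_coe_finset, finsum_mem_coe_finset, Function.comp_apply]
  · have hset : {ab : Fq[X] × Fq[X] | IsCoprime ab.1 ab.2 ∧ homogEval f ab.1 ab.2 ≠ 0 ∧
        ab.1.degree ≤ (N : WithBot ℕ) ∧ ab.2.degree ≤ (N : WithBot ℕ)} =
        ((AlphaEll.coprimePairs Fq (N + 1)).filter
          (fun p => homogEval f p.1 p.2 ≠ 0) : Finset (Fq[X] × Fq[X])) := by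
      ext p
      simp only [hdeg, AlphaEll.coprimePairs, Set.mem_ofPred_eq, Finset.coe_filter,
        Finset.mem_filter, Finset.mem_product]
      tauto
    rw [hset, Set.ncard_coe_finset, finsum_mem_coe_finset, Function.comp_apply, Finset.sum_filter,
      Finset.card_filter, Nat.cast_sum]
    simp only [AlphaEll.homogVal, Nat.cast_ite, Nat.cast_one, Nat.cast_zero]
  · rw [AlphaEll.tsum_rootPairs hw hs]
end

section
/- Let q be a prime power, f ∈ F_q[t][x] with deg_x f = d ≥ 1 which is separable and squarefree as a polynomial in x over F_q(t), and ℓ ∈ F_q[t] monic irreducible not dividing the gcd of the coefficients of f. Then the average A(v_ℓ(F(a,b)), {(a,b) ∈ F_q[t]² : ℓ ∤ gcd(a,b), F(a,b) ≠ 0}) exists and equals Σ_{(r,k) ∈ S(f,ℓ)} Norm(ℓ)^{−k} · Norm(ℓ)/(Norm(ℓ)+1). -/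
open Polynomial Filter

noncomputable section PolynomialCounting

open scoped Classical

variable {Fq : Type*} [Field Fq] [Fintype Fq]

/-- The finite set of polynomials of degree less than `n` over a finite field. -/
def degreeLTFinset (Fq : Type*) [Field Fq] [Fintype Fq] (n : ℕ) : Finset Fq[X] :=
  (Set.finite_coe_iff.mp (Finite.of_equiv _ (degreeLTEquiv Fq n).symm.toEquiv) :
    (degreeLT Fq n : Set Fq[X]).Finite).toFinset

lemma mem_degreeLTFinset {n : ℕ} {p : Fq[X]} : p ∈ degreeLTFinset Fq n ↔ p.degree < n := by
  simp [degreeLTFinset, mem_degreeLT]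

lemma card_degreeLTFinset (n : ℕ) : (degreeLTFinset Fq n).card = Fintype.card Fq ^ n := by
  rw [degreeLTFinset, ← Set.ncard_eq_toFinset_card _ _, ← Nat.card_coe_set_eq]
  exact (Nat.card_congr (degreeLTEquiv Fq n).toEquiv).trans (by simp)

lemma card_filter_dvd_sub {h : Fq[X]} (hh : h.Monic) {n : ℕ} (hn : h.natDegree ≤ n) (c : Fq[X]) :
    ((degreeLTFinset Fq n).filter (fun a => h ∣ a - c)).card =
      Fintype.card Fq ^ (n - h.natDegree) := by
  rw [← card_degreeLTFinset]
  have hdeg : h.degree = (h.natDegree : WithBot ℕ) := degree_eq_natDegree hh.ne_zero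
  symm
  refine Finset.card_nbij' (fun s => c %ₘ h + h * s) (fun a => a /ₘ h) ?_ ?_ ?_ ?_
  · intro s hs
    simp only [Finset.coe_filter, Set.mem_ofPred_eq, Finset.mem_coe, mem_degreeLTFinset] at hs ⊢
    refine ⟨(degree_add_le _ _).trans_lt (max_lt ?_ ?_), ?_⟩
    · refine (degree_modByMonic_lt c hh).trans_le ?_
      rw [hdeg]; exact_mod_cast hn
    · by_cases h0 : s = 0
      · simp [h0]
      rw [degree_mul, hdeg, degree_eq_natDegree h0]
      rw [degree_eq_natDegree h0] at hs
      have : s.natDegree < n - h.natDegree := by exact_mod_cast hs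
      have : h.natDegree + s.natDegree < n := by omega
      exact_mod_cast this
    · have := modByMonic_add_div c h
      exact ⟨s - c /ₘ h, by linear_combination this⟩
  · intro a ha
    simp only [Finset.coe_filter, Set.mem_ofPred_eq, Finset.mem_coe, mem_degreeLTFinset] at ha ⊢
    by_cases h0 : a /ₘ h = 0
    · simp [h0]
    rw [degree_eq_natDegree h0, natDegree_divByMonic a hh]
    have ha0 : a ≠ 0 := by rintro rfl; simp at h0
    have h1 : a.natDegree < n := by
      have := ha.1
      rw [degree_eq_natDegree ha0] at this
      exact_mod_cast this
    have h2 : h.natDegree ≤ a.natDegree := by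
      by_contra hlt
      exact h0 ((divByMonic_eq_zero_iff hh).2 (degree_lt_degree (not_le.mp hlt)))
    have : a.natDegree - h.natDegree < n - h.natDegree := by omega
    exact_mod_cast this
  · intro s _
    exact (div_modByMonic_unique s (c %ₘ h) hh ⟨rfl, degree_modByMonic_lt c hh⟩).1
  · intro a ha
    simp only [Finset.coe_filter, Set.mem_ofPred_eq] at ha
    have : c %ₘ h = a %ₘ h := by
      have := (modByMonic_eq_zero_iff_dvd hh).2 ha.2
      rw [sub_modByMonic, sub_eq_zero] at this
      exact this.symm
    simp only [this]
    exact modByMonic_add_div a h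

lemma card_filter_of_congr {h : Fq[X]} (hh : h.Monic) {n : ℕ} (hn : h.natDegree ≤ n)
    {b : Fq[X]} (hb : IsCoprime h b) {A P : Fq[X] → Prop}
    (hAP : ∀ a r, h ∣ a - b * r → (A a ↔ P r)) :
    ((degreeLTFinset Fq n).filter A).card =
      ((degreeLTFinset Fq h.natDegree).filter P).card *
        Fintype.card Fq ^ (n - h.natDegree) := by
  have hdeg : h.degree = (h.natDegree : WithBot ℕ) := degree_eq_natDegree hh.ne_zero
  have key : (degreeLTFinset Fq n).filter A =
      ((degreeLTFinset Fq h.natDegree).filter P).biUnion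
        (fun r => (degreeLTFinset Fq n).filter (fun a => h ∣ a - b * r)) := by
    ext a
    simp only [Finset.mem_filter, Finset.mem_biUnion]
    constructor
    · rintro ⟨ha, hA⟩
      obtain ⟨u, v, huv⟩ := hb
      have hd : h ∣ a - b * ((a * v) %ₘ h) := by
        have := modByMonic_add_div (a * v) h
        exact ⟨a * u + b * ((a * v) /ₘ h), by linear_combination (-a) * huv - b * this⟩
      refine ⟨(a * v) %ₘ h, ⟨?_, (hAP _ _ hd).1 hA⟩, ha, hd⟩
      rw [mem_degreeLTFinset, ← hdeg]
      exact degree_modByMonic_lt _ hh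
    · rintro ⟨r, ⟨_, hP⟩, ha, hd⟩
      exact ⟨ha, (hAP _ _ hd).2 hP⟩
  rw [key, Finset.card_biUnion, Finset.sum_congr rfl (fun r _ => card_filter_dvd_sub hh hn (b * r)),
    Finset.sum_const, smul_eq_mul]
  intro r hr s hs hrs
  rw [Function.onFun, Finset.disjoint_left]
  intro a h1 h2
  simp only [Finset.coe_filter, Set.mem_ofPred_eq, Finset.mem_filter, mem_degreeLTFinset] at h1 h2 hr hs
  apply hrs
  have h3 : h ∣ b * (s - r) := by
    have := dvd_sub h1.2 h2.2
    convert this using 1; ring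
  have h4 : h ∣ s - r := hb.dvd_of_dvd_mul_left h3
  have h5 : (s - r).degree < h.degree := by
    rw [hdeg]
    exact (degree_sub_le _ _).trans_lt (max_lt hs.1 hr.1)
  exact (sub_eq_zero.1 (eq_zero_of_dvd_of_degree_lt h4 h5)).symm

/-- If `g'` has bounded valuation at the roots of `g` modulo high powers of `ℓ`, then congruent
roots modulo `ℓ ^ k` are very close to each other. -/
lemma pow_dvd_sub_of_pow_dvd_eval {F : Type*} [Field F] {g : F[X][X]} {ℓ : F[X]} (hirr : Irreducible ℓ) {m k : ℕ}
    {r s : F[X]} (hr : ℓ ^ k ∣ g.eval r) (hs : ℓ ^ k ∣ g.eval s)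
    (hder : ¬ ℓ ^ (m + 1) ∣ g.derivative.eval r) (hrs : ℓ ^ (m + 1) ∣ s - r) :
    ℓ ^ (k - m) ∣ s - r := by
  have hp : Prime ℓ := hirr.prime
  by_cases h0 : s - r = 0
  · simp [h0]
  have h1 : g.derivative.eval r ≠ 0 := fun h => hder (h ▸ dvd_zero _)
  obtain ⟨u, hu, hu'⟩ :=
    (FiniteMultiplicity.of_prime_left hp h0).exists_eq_pow_mul_and_not_dvd
  obtain ⟨w, hw, hw'⟩ :=
    (FiniteMultiplicity.of_prime_left hp h1).exists_eq_pow_mul_and_not_dvd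
  set j := multiplicity ℓ (s - r)
  set i := multiplicity ℓ (g.derivative.eval r)
  have hj : m + 1 ≤ j := by
    by_contra hlt
    rw [hu] at hrs
    have : ℓ ^ (j + 1) ∣ ℓ ^ j * u := (pow_dvd_pow _ (by omega)).trans hrs
    rw [pow_succ] at this
    exact hu' ((mul_dvd_mul_iff_left (pow_ne_zero _ hp.ne_zero)).1 this)
  have hi : i ≤ m := by
    by_contra hlt
    exact hder (hw ▸ (pow_dvd_pow _ (by omega)).trans (dvd_mul_right _ _))
  obtain ⟨c, hc⟩ := g.binomExpansion r (s - r)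
  rw [add_sub_cancel] at hc
  obtain ⟨n, hn⟩ : ∃ n, j = i + (n + 1) := ⟨j - i - 1, by omega⟩
  have hk : ℓ ^ k ∣ ℓ ^ (i + j) * (w * u + ℓ * (c * u ^ 2 * ℓ ^ n)) := by
    have h2 := dvd_sub hs hr
    convert h2 using 1
    rw [hc]
    have e1 : ℓ ^ (i + j) * (ℓ * (c * u ^ 2 * ℓ ^ n)) = c * (s - r) ^ 2 := by
      rw [hu]
      have : ℓ ^ j = ℓ ^ (i + (n + 1)) := by rw [hn]
      linear_combination (c * u ^ 2 * ℓ ^ j) * (-this)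
    linear_combination e1 - w * ℓ ^ i * hu - (s - r) * hw
  have hkij : k ≤ i + j := by
    by_contra hlt
    have : ℓ ^ (i + j + 1) ∣ ℓ ^ (i + j) * (w * u + ℓ * (c * u ^ 2 * ℓ ^ n)) :=
      (pow_dvd_pow _ (by omega)).trans hk
    rw [pow_succ] at this
    have h3 := (mul_dvd_mul_iff_left (pow_ne_zero _ hp.ne_zero)).1 this
    rcases hp.dvd_or_dvd ((dvd_add_left (dvd_mul_right _ _)).1 h3) with h | h
    exacts [hw' h, hu' h]
  rw [hu]
  exact (pow_dvd_pow _ (by omega)).trans (dvd_mul_right _ _)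

/-- A polynomial that is separable over `F_q(t)` has boundedly many roots modulo `ℓ ^ k`. -/
lemma exists_card_roots_mod_pow_le {g : Fq[X][X]} {ℓ : Fq[X]} (hmonic : ℓ.Monic)
    (hirr : Irreducible ℓ) (hsep : (g.map (algebraMap Fq[X] (RatFunc Fq))).Separable) :
    ∃ C : ℕ, ∀ k, ((degreeLTFinset Fq (k * ℓ.natDegree)).filter
      (fun r => ℓ ^ k ∣ g.eval r)).card ≤ C := by
  obtain ⟨c, hc0, u, v, huv⟩ : ∃ c : Fq[X], c ≠ 0 ∧ ∃ u v : Fq[X][X],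
      u * g + v * g.derivative = C c := by
    obtain ⟨u, v, huv⟩ := hsep
    obtain ⟨b, hb, hu⟩ := IsLocalization.integerNormalization_spec (nonZeroDivisors Fq[X]) u
    obtain ⟨b', hb', hv⟩ := IsLocalization.integerNormalization_spec (nonZeroDivisors Fq[X]) v
    set u' := IsLocalization.integerNormalization (nonZeroDivisors Fq[X]) u
    set v' := IsLocalization.integerNormalization (nonZeroDivisors Fq[X]) v
    refine ⟨b * b', mul_ne_zero (nonZeroDivisors.ne_zero hb) (nonZeroDivisors.ne_zero hb'),
      C b' * u', C b * v', ?_⟩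
    apply map_injective (algebraMap Fq[X] (RatFunc Fq)) (IsFractionRing.injective _ _)
    simp only [Polynomial.map_add, Polynomial.map_mul, map_C, hu, hv, ← derivative_map,
      map_mul, Algebra.smul_def, Polynomial.algebraMap_apply]
    linear_combination (C (algebraMap Fq[X] (RatFunc Fq) b) * C (algebraMap Fq[X] (RatFunc Fq) b')) * huv
  set m := multiplicity ℓ c
  have hm : ¬ ℓ ^ (m + 1) ∣ c :=
    (FiniteMultiplicity.of_prime_left hirr.prime hc0).not_pow_dvd_of_multiplicity_lt
      (Nat.lt_succ_self _)
  have hder : ∀ k, m < k → ∀ r, ℓ ^ k ∣ g.eval r → ¬ ℓ ^ (m + 1) ∣ g.derivative.eval r := by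
    intro k hk r hr hr'
    apply hm
    have h := congrArg (eval r) huv
    simp only [eval_add, eval_mul, eval_C] at h
    rw [← h]
    exact dvd_add (((pow_dvd_pow _ hk).trans hr).mul_left _) (hr'.mul_left _)
  have hdeg : ∀ n, (ℓ ^ n).natDegree = n * ℓ.natDegree := fun n => hmonic.natDegree_pow n
  refine ⟨Fintype.card Fq ^ ((2 * m + 1) * ℓ.natDegree), fun k => ?_⟩
  by_cases hk : k ≤ 2 * m + 1
  · refine (Finset.card_filter_le _ _).trans ?_
    rw [card_degreeLTFinset]
    exact Nat.pow_le_pow_right Fintype.card_pos (Nat.mul_le_mul_right _ hk)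
  push Not at hk
  set S := (degreeLTFinset Fq (k * ℓ.natDegree)).filter (fun r => ℓ ^ k ∣ g.eval r) with hS
  have h1 : S.card ≤ Fintype.card Fq ^ (m * ℓ.natDegree) *
      (S.image (fun r => r %ₘ ℓ ^ (m + 1))).card := by
    refine Finset.card_le_mul_card_image S _ ?_
    intro y hy
    obtain ⟨r, hr, rfl⟩ := Finset.mem_image.1 hy
    have hle : (ℓ ^ (k - m)).natDegree ≤ k * ℓ.natDegree := by
      rw [hdeg]; exact Nat.mul_le_mul_right _ (Nat.sub_le _ _)
    have := card_filter_dvd_sub (hmonic.pow (k - m)) hle r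
    rw [hdeg, ← Nat.sub_mul, Nat.sub_sub_self (by omega)] at this
    rw [← this]
    apply Finset.card_le_card
    intro s hs
    simp only [hS, Finset.mem_filter] at hr hs ⊢
    refine ⟨hs.1.1, pow_dvd_sub_of_pow_dvd_eval hirr hr.2 hs.1.2 (hder k (by omega) r hr.2) ?_⟩
    rw [← modByMonic_eq_zero_iff_dvd (hmonic.pow _), sub_modByMonic, hs.2, sub_self]
  have h2 : (S.image (fun r => r %ₘ ℓ ^ (m + 1))).card ≤
      Fintype.card Fq ^ ((m + 1) * ℓ.natDegree) := by
    rw [← card_degreeLTFinset]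
    apply Finset.card_le_card
    intro y hy
    obtain ⟨r, hr, rfl⟩ := Finset.mem_image.1 hy
    rw [mem_degreeLTFinset, ← hdeg, ← degree_eq_natDegree (hmonic.pow _).ne_zero]
    exact degree_modByMonic_lt _ (hmonic.pow _)
  refine (h1.trans (Nat.mul_le_mul_left _ h2)).trans (le_of_eq ?_)
  rw [← pow_add]
  congr 1
  ring

/-- The reversal `F(1,x)` of a separable polynomial is separable. -/
lemma separable_sum_coeff_mul_X_pow {K : Type*} [Field K] {p : K[X]} (hp : p.Separable) :
    (∑ i ∈ Finset.range (p.natDegree + 1), C (p.coeff i) * X ^ (p.natDegree - i)).Separable := by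
  set d := p.natDegree
  rw [Polynomial.Separable, isCoprime_iff_aeval_ne_zero_of_isAlgClosed K (AlgebraicClosure K)] at hp ⊢
  intro a
  by_contra! hcon
  obtain ⟨h1, h2⟩ := hcon
  simp only [derivative_C_mul, derivative_X_pow, map_sum, map_mul, aeval_C, map_pow,
    aeval_X, map_natCast] at h1 h2
  by_cases ha : a = 0
  · subst ha
    rw [Finset.sum_range_succ, Finset.sum_eq_zero] at h1
    · simp [d] at h1
      subst h1
      simp at hp
    · intro i hi
      rw [Finset.mem_range] at hi
      rw [zero_pow (by omega), mul_zero]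
  set φ := algebraMap K (AlgebraicClosure K)
  have e1 : aeval a⁻¹ p = 0 := by
    have : a ^ d * aeval a⁻¹ p = 0 := by
      rw [← h1, aeval_eq_sum_range, Finset.mul_sum]
      refine Finset.sum_congr rfl fun i hi => ?_
      rw [Finset.mem_range] at hi
      rw [Algebra.smul_def, pow_sub₀ _ ha (by omega), inv_pow]
      ring
    exact (mul_eq_zero.1 this).resolve_left (pow_ne_zero _ ha)
  have e2 : aeval a⁻¹ p.derivative = 0 := by
    have hsum : aeval a⁻¹ p.derivative =
        ∑ i ∈ Finset.range (d + 1), φ (p.coeff i) * (i * a⁻¹ ^ (i - 1)) := by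
      conv_lhs => rw [p.as_sum_range]
      simp only [map_sum, derivative_monomial, aeval_monomial, map_mul,
        map_natCast, φ, d, mul_assoc]
    have : a ^ d * (a⁻¹ * aeval a⁻¹ p.derivative) = 0 := by
      have h3 : d * ∑ i ∈ Finset.range (d + 1), φ (p.coeff i) * a ^ (d - i) -
        a * ∑ i ∈ Finset.range (d + 1), φ (p.coeff i) * ((d - i : ℕ) * a ^ (d - i - 1)) = 0 := by
        rw [h1, h2]; simp
      rw [← h3, hsum, Finset.mul_sum, Finset.mul_sum, Finset.mul_sum, Finset.mul_sum,
        ← Finset.sum_sub_distrib]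
      refine Finset.sum_congr rfl fun i hi => ?_
      rw [Finset.mem_range] at hi
      obtain ⟨j, hj⟩ : ∃ j, d = i + j := ⟨d - i, by omega⟩
      rw [hj, Nat.add_sub_cancel_left]
      have e3 : (j : AlgebraicClosure K) * (a * a ^ (j - 1)) = j * a ^ j := by
        rcases j with _ | j
        · simp
        · simp [pow_succ']
      have e4 : (i : AlgebraicClosure K) * (a ^ i * (a⁻¹ * a⁻¹ ^ (i - 1))) = i := by
        rcases i with _ | i
        · simp
        · rw [Nat.add_sub_cancel, ← pow_succ', ← mul_pow, mul_inv_cancel₀ ha]; simp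
      push_cast
      rw [pow_add]
      linear_combination φ (p.coeff i) * a ^ j * e4 + φ (p.coeff i) * e3
    exact (mul_eq_zero.1 ((mul_eq_zero.1 this).resolve_left (pow_ne_zero _ ha))).resolve_left
      (inv_ne_zero ha)
  rcases hp a⁻¹ with h | h
  exacts [h e1, h e2]

section HomogEval

variable {F : Type*} [Field F] (f : F[X][X])

lemma homogEval_sub_dvd {h a b a' b' : F[X]} (ha : h ∣ a - a') (hb : h ∣ b - b') :
    h ∣ homogEval f a b - homogEval f a' b' := by
  rw [homogEval, homogEval, ← Finset.sum_sub_distrib]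
  refine Finset.dvd_sum fun i _ => ?_
  have h1 := ha.trans (sub_dvd_pow_sub_pow a a' i)
  have h2 := hb.trans (sub_dvd_pow_sub_pow b b' (f.natDegree - i))
  have : f.coeff i * a ^ i * b ^ (f.natDegree - i) - f.coeff i * a' ^ i * b' ^ (f.natDegree - i) =
    f.coeff i * b ^ (f.natDegree - i) * (a ^ i - a' ^ i) +
      f.coeff i * a' ^ i * (b ^ (f.natDegree - i) - b' ^ (f.natDegree - i)) := by ring
  rw [this]
  exact dvd_add (h1.mul_left _) (h2.mul_left _)

lemma homogEval_mul (c a b : F[X]) :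
    homogEval f (c * a) (c * b) = c ^ f.natDegree * homogEval f a b := by
  rw [homogEval, homogEval, Finset.mul_sum]
  refine Finset.sum_congr rfl fun i hi => ?_
  rw [Finset.mem_range] at hi
  have : c ^ f.natDegree = c ^ i * c ^ (f.natDegree - i) := by rw [← pow_add]; congr 1; omega
  rw [this, mul_pow, mul_pow]
  ring

lemma homogEval_one_right (r : F[X]) : homogEval f r 1 = f.eval r := by
  simp [homogEval, eval_eq_sum_range]

/-- The dehomogenization `F(1,x)`. -/
def dehomogOneLeft : F[X][X] :=
  ∑ i ∈ Finset.range (f.natDegree + 1), C (f.coeff i) * X ^ (f.natDegree - i)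

lemma eval_dehomogOneLeft (r : F[X]) : (dehomogOneLeft f).eval r = homogEval f 1 r := by
  simp [homogEval, dehomogOneLeft, eval_finsetSum]

lemma separable_map_dehomogOneLeft
    (hsep : (f.map (algebraMap F[X] (RatFunc F))).Separable) :
    ((dehomogOneLeft f).map (algebraMap F[X] (RatFunc F))).Separable := by
  have h := separable_sum_coeff_mul_X_pow hsep
  rw [natDegree_map_eq_of_injective (IsFractionRing.injective F[X] (RatFunc F))] at h
  simpa [dehomogOneLeft, Polynomial.map_sum] using h

variable {f}

/-- For `b` prime to `h`, divisibility of `F(a,b)` by `h` only depends on `a / b` modulo `h`. -/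
lemma dvd_homogEval_iff_affine {h a b r : F[X]} (hb : IsCoprime h b) (hr : h ∣ a - b * r) :
    h ∣ homogEval f a b ↔ h ∣ f.eval r := by
  have h1 : h ∣ homogEval f a b - homogEval f (b * r) (b * 1) :=
    homogEval_sub_dvd f hr (by simp)
  rw [homogEval_mul, homogEval_one_right] at h1
  rw [dvd_iff_dvd_of_dvd_sub h1]
  exact ⟨fun h => hb.pow_right.dvd_of_dvd_mul_left h, fun h => h.mul_left _⟩

lemma dvd_homogEval_iff_projective {h a b r : F[X]} (ha : IsCoprime h a) (hr : h ∣ b - a * r) :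
    h ∣ homogEval f a b ↔ h ∣ homogEval f 1 r := by
  have h1 : h ∣ homogEval f a b - homogEval f (a * 1) (a * r) :=
    homogEval_sub_dvd f (by simp) hr
  rw [homogEval_mul] at h1
  rw [dvd_iff_dvd_of_dvd_sub h1]
  exact ⟨fun h => ha.pow_right.dvd_of_dvd_mul_left h, fun h => h.mul_left _⟩

variable (f) in
/-- The degree of `F(a,b)` grows at most linearly in the degree of `(a,b)`. -/
lemma exists_natDegree_homogEval_le :
    ∃ D : ℕ, ∀ N : ℕ, ∀ a b : F[X], a.natDegree ≤ N → b.natDegree ≤ N →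
      (homogEval f a b).natDegree ≤ D + f.natDegree * N := by
  refine ⟨∑ i ∈ Finset.range (f.natDegree + 1), (f.coeff i).natDegree, fun N a b ha hb => ?_⟩
  refine natDegree_sum_le_of_forall_le _ _ fun i hi => ?_
  have h1 : (f.coeff i).natDegree ≤
      ∑ i ∈ Finset.range (f.natDegree + 1), (f.coeff i).natDegree :=
    Finset.single_le_sum (f := fun i => (f.coeff i).natDegree) (fun _ _ => Nat.zero_le _) hi
  rw [Finset.mem_range] at hi
  have h2 : (a ^ i).natDegree ≤ i * N := natDegree_pow_le.trans (Nat.mul_le_mul_left _ ha)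
  have h3 : (b ^ (f.natDegree - i)).natDegree ≤ (f.natDegree - i) * N :=
    natDegree_pow_le.trans (Nat.mul_le_mul_left _ hb)
  have h4 : i * N + (f.natDegree - i) * N = f.natDegree * N := by
    rw [← Nat.add_mul]; congr 1; omega
  have h5 := (f.coeff i * a ^ i).natDegree_mul_le (q := b ^ (f.natDegree - i))
  have h6 := (f.coeff i).natDegree_mul_le (q := a ^ i)
  omega

end HomogEval

/-- `F(a,b)` vanishes at few pairs. -/
lemma card_homogEval_eq_zero_le {f : Fq[X][X]} (hf : f ≠ 0) (n : ℕ) :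
    ((degreeLTFinset Fq n ×ˢ degreeLTFinset Fq n).filter
      (fun ab => homogEval f ab.1 ab.2 = 0)).card ≤ (f.natDegree + 1) * Fintype.card Fq ^ n := by
  rw [← card_degreeLTFinset]
  set B := degreeLTFinset Fq n
  set T := (B ×ˢ B).filter (fun ab => homogEval f ab.1 ab.2 = 0)
  have h1 : ∀ b ∈ B, (T.filter (fun ab => ab.2 = b)).card ≤ f.natDegree + 1 := by
    intro b _
    set p : Fq[X][X] := ∑ i ∈ Finset.range (f.natDegree + 1),
      C (f.coeff i * b ^ (f.natDegree - i)) * X ^ i with hp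
    have hcoeff : p.coeff f.natDegree = f.leadingCoeff := by
      simp only [hp, finsetSum_coeff, coeff_C_mul_X_pow]
      simp
    have hp0 : p ≠ 0 := by
      intro h
      rw [h, coeff_zero] at hcoeff
      exact hf (leadingCoeff_eq_zero.1 hcoeff.symm)
    have hdeg : p.natDegree ≤ f.natDegree := by
      refine natDegree_sum_le_of_forall_le _ _ fun i hi => ?_
      rw [Finset.mem_range] at hi
      exact (natDegree_C_mul_X_pow_le _ _).trans (by omega)
    have hsub : (T.filter (fun ab => ab.2 = b)).card ≤ p.roots.toFinset.card := by
      refine Finset.card_le_card_of_injOn Prod.fst ?_ ?_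
      · rintro ⟨a, b'⟩ hab
        simp only [T, Finset.coe_filter, Finset.mem_filter, Set.mem_ofPred_eq] at hab
        obtain ⟨⟨_, h0⟩, rfl⟩ := hab
        simp only [Finset.mem_coe, Multiset.mem_toFinset, mem_roots hp0, IsRoot.def]
        rw [← h0, hp, homogEval, eval_finsetSum]
        refine Finset.sum_congr rfl fun i _ => ?_
        simp; ring
      · rintro ⟨a, b1⟩ h1 ⟨a', b2⟩ h2 h
        simp only [Finset.coe_filter, Set.mem_ofPred_eq] at h1 h2 h
        rw [Prod.mk.injEq]
        exact ⟨h, h1.2.trans h2.2.symm⟩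
    exact ((hsub.trans (Multiset.toFinset_card_le _)).trans (card_roots' p)).trans (by omega)
  have h2 : T.card = ∑ b ∈ B, (T.filter (fun ab => ab.2 = b)).card := by
    refine Finset.card_eq_sum_card_fiberwise fun ab hab => ?_
    simp only [T, Finset.coe_filter, Set.mem_ofPred_eq, Finset.mem_product] at hab
    exact hab.1.2
  rw [h2, mul_comm, ← smul_eq_mul]
  exact Finset.sum_le_card_nsmul _ _ _ h1

section RootCount

variable (f : Fq[X][X]) (ℓ : Fq[X])

/-- The affine roots of `f` modulo `ℓ ^ k`. -/
def affineRoots (k : ℕ) : Finset Fq[X] :=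
  (degreeLTFinset Fq (k * ℓ.natDegree)).filter (fun r => ℓ ^ k ∣ f.eval r)

/-- The projective roots of `f` modulo `ℓ ^ k`. -/
def projectiveRoots (k : ℕ) : Finset Fq[X] :=
  (degreeLTFinset Fq (k * ℓ.natDegree)).filter (fun r => ℓ ∣ r ∧ ℓ ^ k ∣ homogEval f 1 r)

/-- The number of affine and projective roots of `f` modulo `ℓ ^ k`. -/
def rootCount (k : ℕ) : ℕ := (affineRoots f ℓ k).card + (projectiveRoots f ℓ k).card

variable {f ℓ}

lemma exists_rootCount_le (hmonic : ℓ.Monic) (hirr : Irreducible ℓ)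
    (hsep : (f.map (algebraMap Fq[X] (RatFunc Fq))).Separable) :
    ∃ C : ℕ, ∀ k, rootCount f ℓ k ≤ C := by
  obtain ⟨C₁, h₁⟩ := exists_card_roots_mod_pow_le hmonic hirr hsep
  obtain ⟨C₂, h₂⟩ := exists_card_roots_mod_pow_le hmonic hirr (separable_map_dehomogOneLeft f hsep)
  refine ⟨C₁ + C₂, fun k => add_le_add (h₁ k) (le_trans (Finset.card_le_card ?_) (h₂ k))⟩
  intro r hr
  simp only [projectiveRoots, Finset.mem_filter, eval_dehomogOneLeft] at hr ⊢
  exact ⟨hr.1, hr.2.2⟩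

lemma card_filter_product_of_fiber {α β : Type*} (s : Finset α) (t : Finset β) {U : β → Prop}
    {A : α → β → Prop} {c : ℕ} (h : ∀ b ∈ t, U b → (s.filter (fun a => A a b)).card = c) :
    ((s ×ˢ t).filter (fun ab => U ab.2 ∧ A ab.1 ab.2)).card = (t.filter U).card * c := by
  rw [Finset.card_filter, Finset.sum_product_right, ← smul_eq_mul, ← Finset.sum_const,
    Finset.sum_filter]
  refine Finset.sum_congr rfl fun b hb => ?_
  by_cases hU : U b
  · simp only [hU, true_and, if_true, ← h b hb hU, Finset.card_filter]
  · simp [hU]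

lemma card_filter_product_of_fiber' {α β : Type*} (s : Finset α) (t : Finset β) {U : α → Prop}
    {A : α → β → Prop} {c : ℕ} (h : ∀ a ∈ s, U a → (t.filter (fun b => A a b)).card = c) :
    ((s ×ˢ t).filter (fun ab => U ab.1 ∧ A ab.1 ab.2)).card = (s.filter U).card * c := by
  rw [Finset.card_filter, Finset.sum_product, ← smul_eq_mul, ← Finset.sum_const,
    Finset.sum_filter]
  refine Finset.sum_congr rfl fun a ha => ?_
  by_cases hU : U a
  · simp only [hU, true_and, if_true, ← h a ha hU, Finset.card_filter]
  · simp [hU]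

lemma card_filter_dvd (hmonic : ℓ.Monic) {n : ℕ} (hn : ℓ.natDegree ≤ n) :
    ((degreeLTFinset Fq n).filter (fun a => ℓ ∣ a)).card = Fintype.card Fq ^ (n - ℓ.natDegree) := by
  simpa using card_filter_dvd_sub hmonic hn 0

lemma card_filter_not_dvd (hmonic : ℓ.Monic) {n : ℕ} (hn : ℓ.natDegree ≤ n) :
    (((degreeLTFinset Fq n).filter (fun a => ¬ ℓ ∣ a)).card : ℝ) =
      (Fintype.card Fq : ℝ) ^ n * (1 - ((Fintype.card Fq : ℝ) ^ ℓ.natDegree)⁻¹) := by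
  have h := (degreeLTFinset Fq n).card_filter_add_card_filter_not (fun a => ℓ ∣ a)
  rw [card_filter_dvd hmonic hn, card_degreeLTFinset] at h
  have h' := congrArg (Nat.cast (R := ℝ)) h
  push_cast at h'
  rw [pow_sub₀ _ (by simp) hn] at h'
  linear_combination h'

lemma card_filter_primitive (hmonic : ℓ.Monic) {n : ℕ} (hn : ℓ.natDegree ≤ n) :
    (((degreeLTFinset Fq n ×ˢ degreeLTFinset Fq n).filter
      (fun ab => ¬ (ℓ ∣ ab.1 ∧ ℓ ∣ ab.2))).card : ℝ) =
      ((Fintype.card Fq : ℝ) ^ n) ^ 2 * (1 - (((Fintype.card Fq : ℝ) ^ ℓ.natDegree)⁻¹) ^ 2) := by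
  have h := (degreeLTFinset Fq n ×ˢ degreeLTFinset Fq n).card_filter_add_card_filter_not
    (fun ab => ℓ ∣ ab.1 ∧ ℓ ∣ ab.2)
  rw [Finset.filter_product (fun a => ℓ ∣ a) (fun b => ℓ ∣ b), Finset.card_product,
    Finset.card_product, card_filter_dvd hmonic hn, card_degreeLTFinset] at h
  have h' := congrArg (Nat.cast (R := ℝ)) h
  push_cast at h'
  rw [pow_sub₀ _ (by simp) hn] at h'
  linear_combination h'

lemma card_filter_primitive_pow_dvd (hmonic : ℓ.Monic) (hirr : Irreducible ℓ) {k n : ℕ}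
    (hk : 1 ≤ k) (hn : k * ℓ.natDegree ≤ n) :
    (((degreeLTFinset Fq n ×ˢ degreeLTFinset Fq n).filter
      (fun ab => ¬ (ℓ ∣ ab.1 ∧ ℓ ∣ ab.2) ∧ ℓ ^ k ∣ homogEval f ab.1 ab.2)).card : ℝ) =
      rootCount f ℓ k * (((Fintype.card Fq : ℝ) ^ ℓ.natDegree) ^ k)⁻¹ *
        (1 - ((Fintype.card Fq : ℝ) ^ ℓ.natDegree)⁻¹) * ((Fintype.card Fq : ℝ) ^ n) ^ 2 := by
  set B := degreeLTFinset Fq n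
  have hdeg : (ℓ ^ k).natDegree = k * ℓ.natDegree := hmonic.natDegree_pow k
  have hne : ℓ.natDegree ≤ n := (Nat.le_mul_of_pos_left _ hk).trans hn
  have hcop : ∀ {b : Fq[X]}, ¬ ℓ ∣ b → IsCoprime (ℓ ^ k) b := fun hb =>
    ((hirr.coprime_iff_not_dvd).2 hb).pow_left
  have hsplit : (B ×ˢ B).filter
      (fun ab => ¬ (ℓ ∣ ab.1 ∧ ℓ ∣ ab.2) ∧ ℓ ^ k ∣ homogEval f ab.1 ab.2) =
      (B ×ˢ B).filter (fun ab => ¬ ℓ ∣ ab.2 ∧ ℓ ^ k ∣ homogEval f ab.1 ab.2) ∪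
      (B ×ˢ B).filter (fun ab => ¬ ℓ ∣ ab.1 ∧ (ℓ ∣ ab.2 ∧ ℓ ^ k ∣ homogEval f ab.1 ab.2)) := by
    ext ab
    simp only [Finset.mem_filter, Finset.mem_union]
    tauto
  have hdisj : Disjoint
      ((B ×ˢ B).filter (fun ab => ¬ ℓ ∣ ab.2 ∧ ℓ ^ k ∣ homogEval f ab.1 ab.2))
      ((B ×ˢ B).filter
        (fun ab => ¬ ℓ ∣ ab.1 ∧ (ℓ ∣ ab.2 ∧ ℓ ^ k ∣ homogEval f ab.1 ab.2))) := by
    rw [Finset.disjoint_filter]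
    tauto
  have haff : ((B ×ˢ B).filter (fun ab => ¬ ℓ ∣ ab.2 ∧ ℓ ^ k ∣ homogEval f ab.1 ab.2)).card =
      (B.filter (fun b => ¬ ℓ ∣ b)).card *
        ((affineRoots f ℓ k).card * Fintype.card Fq ^ (n - k * ℓ.natDegree)) := by
    convert card_filter_product_of_fiber B B (U := fun b => ¬ ℓ ∣ b)
      (A := fun a b => ℓ ^ k ∣ homogEval f a b)
      (c := (affineRoots f ℓ k).card * Fintype.card Fq ^ (n - k * ℓ.natDegree)) ?_
    · intro b _ hb
      have := card_filter_of_congr (hmonic.pow k) (hdeg ▸ hn) (hcop hb)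
        (A := fun a => ℓ ^ k ∣ homogEval f a b) (P := fun r => ℓ ^ k ∣ f.eval r)
        (fun a r h => dvd_homogEval_iff_affine (hcop hb) h)
      rw [hdeg] at this
      exact this
  have hproj : ((B ×ˢ B).filter
      (fun ab => ¬ ℓ ∣ ab.1 ∧ (ℓ ∣ ab.2 ∧ ℓ ^ k ∣ homogEval f ab.1 ab.2))).card =
      (B.filter (fun a => ¬ ℓ ∣ a)).card *
        ((projectiveRoots f ℓ k).card * Fintype.card Fq ^ (n - k * ℓ.natDegree)) := by
    convert card_filter_product_of_fiber' B B (U := fun a => ¬ ℓ ∣ a)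
      (A := fun a b => ℓ ∣ b ∧ ℓ ^ k ∣ homogEval f a b)
      (c := (projectiveRoots f ℓ k).card * Fintype.card Fq ^ (n - k * ℓ.natDegree)) ?_
    · intro a _ ha
      have := card_filter_of_congr (hmonic.pow k) (hdeg ▸ hn) (hcop ha)
        (A := fun b => ℓ ∣ b ∧ ℓ ^ k ∣ homogEval f a b)
        (P := fun r => ℓ ∣ r ∧ ℓ ^ k ∣ homogEval f 1 r)
        (fun b r h => by
          refine and_congr ?_ (dvd_homogEval_iff_projective (hcop ha) h)
          rw [dvd_iff_dvd_of_dvd_sub ((dvd_pow_self ℓ (by omega)).trans h)]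
          exact ⟨fun h => (hirr.prime.dvd_or_dvd h).resolve_left ha, fun h => h.mul_left _⟩)
      rw [hdeg] at this
      rw [projectiveRoots]
      convert this
  rw [hsplit, Finset.card_union_of_disjoint hdisj, haff, hproj, rootCount]
  push_cast
  rw [card_filter_not_dvd hmonic hne, pow_sub₀ _ (by simp) hn, mul_comm k, pow_mul]
  ring

lemma hasSum_rootPairs {w : ℕ → ℝ} (hw : ∀ k, 0 ≤ w k)
    (hs : Summable (fun j => rootCount f ℓ (j + 1) * w (j + 1))) :
    HasSum (fun x : rootPairs f ℓ => w (x : Bool × Fq[X] × ℕ).2.2)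
      (∑' j, rootCount f ℓ (j + 1) * w (j + 1)) := by
  let g : (Σ j : ℕ, affineRoots f ℓ (j + 1) ⊕ projectiveRoots f ℓ (j + 1)) → rootPairs f ℓ
    | ⟨j, Sum.inl r⟩ => ⟨(true, r, j + 1), by
        have := r.2
        simp only [affineRoots, Finset.mem_filter, mem_degreeLTFinset] at this
        exact ⟨by simp, this.1, Or.inl ⟨rfl, this.2⟩⟩⟩
    | ⟨j, Sum.inr r⟩ => ⟨(false, r, j + 1), by
        have := r.2
        simp only [projectiveRoots, Finset.mem_filter, mem_degreeLTFinset] at this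
        exact ⟨by simp, this.1, Or.inr ⟨rfl, this.2⟩⟩⟩
  have hg : Function.Bijective g := by
    constructor
    · rintro ⟨i, r | r⟩ ⟨j, s | s⟩ h <;>
        replace h := congrArg Subtype.val h <;> simp only [g, Prod.mk.injEq] at h
      · obtain ⟨_, h1, h2⟩ := h
        obtain rfl : i = j := by omega
        rw [Subtype.ext h1]
      · exact absurd h.1 (by simp)
      · exact absurd h.1 (by simp)
      · obtain ⟨_, h1, h2⟩ := h
        obtain rfl : i = j := by omega
        rw [Subtype.ext h1]
    · rintro ⟨⟨t, r, k⟩, hx⟩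
      have ⟨hk, hd, h⟩ := hx
      obtain ⟨j, rfl⟩ : ∃ j, k = j + 1 := ⟨k - 1, by simp only at hk; omega⟩
      rcases h with ⟨ht, h⟩ | ⟨ht, h⟩ <;> simp only at ht <;> subst ht
      · exact ⟨⟨j, Sum.inl ⟨r, by
          simpa only [affineRoots, Finset.mem_filter, mem_degreeLTFinset] using ⟨hd, h⟩⟩⟩, rfl⟩
      · exact ⟨⟨j, Sum.inr ⟨r, by
          simpa only [projectiveRoots, Finset.mem_filter, mem_degreeLTFinset] using ⟨hd, h⟩⟩⟩, rfl⟩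
  rw [← (Equiv.ofBijective g hg).hasSum_iff]
  have hcomp : (fun x : rootPairs f ℓ => w (x : Bool × Fq[X] × ℕ).2.2) ∘ Equiv.ofBijective g hg =
      fun y => w (y.1 + 1) := by
    funext ⟨j, r⟩
    rcases r with r | r <;> rfl
  have hinner : ∀ j, ∑' _ : affineRoots f ℓ (j + 1) ⊕ projectiveRoots f ℓ (j + 1), w (j + 1) =
      rootCount f ℓ (j + 1) * w (j + 1) := by
    intro j
    simp [tsum_fintype, rootCount]
  rw [hcomp]
  have hsum : Summable (fun y : (Σ j : ℕ, affineRoots f ℓ (j + 1) ⊕ projectiveRoots f ℓ (j + 1)) =>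
      w (y.1 + 1)) := by
    rw [summable_sigma_of_nonneg (fun _ => hw _)]
    refine ⟨fun j => Summable.of_finite, ?_⟩
    simpa only [hinner] using hs
  have := hsum.hasSum
  rwa [hsum.tsum_sigma' (fun j => Summable.of_finite), tsum_congr hinner] at this

lemma multiplicity_eq_sum {F : Type*} [Field F] {ℓ p : F[X]} (hirr : Irreducible ℓ) (hp : p ≠ 0) {K : ℕ}
    (hK : p.natDegree ≤ K) :
    multiplicity ℓ p = ∑ j ∈ Finset.range K, if ℓ ^ (j + 1) ∣ p then 1 else 0 := by
  have hfin : FiniteMultiplicity ℓ p := FiniteMultiplicity.of_prime_left hirr.prime hp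
  have hle : multiplicity ℓ p ≤ K := by
    have h1 := natDegree_le_of_dvd (pow_multiplicity_dvd ℓ p) hp
    rw [natDegree_pow] at h1
    exact ((Nat.le_mul_of_pos_right _ hirr.natDegree_pos).trans h1).trans hK
  rw [← Finset.card_filter]
  have : (Finset.range K).filter (fun j => ℓ ^ (j + 1) ∣ p) =
      Finset.range (multiplicity ℓ p) := by
    ext j
    rw [Finset.mem_filter, hfin.pow_dvd_iff_le_multiplicity, Finset.mem_range, Finset.mem_range]
    omega
  rw [this, Finset.card_range]

variable (f ℓ) in
/-- The pairs `(a,b)` of polynomials of degree less than `n` with `ℓ ∤ gcd(a,b)` and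
`F(a,b) ≠ 0`. -/
def coprimePairs (n : ℕ) : Finset (Fq[X] × Fq[X]) :=
  (degreeLTFinset Fq n ×ˢ degreeLTFinset Fq n).filter
    (fun ab => ¬ (ℓ ∣ ab.1 ∧ ℓ ∣ ab.2) ∧ homogEval f ab.1 ab.2 ≠ 0)

lemma abs_card_filter_homogEval_ne_zero_sub_le (hf : f ≠ 0) (n : ℕ) (A : Fq[X] × Fq[X] → Prop) :
    |((((degreeLTFinset Fq n ×ˢ degreeLTFinset Fq n).filter A).filter
        (fun ab => homogEval f ab.1 ab.2 ≠ 0)).card : ℝ) -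
      (((degreeLTFinset Fq n ×ˢ degreeLTFinset Fq n).filter A).card : ℝ)| ≤
      (f.natDegree + 1) * (Fintype.card Fq : ℝ) ^ n := by
  set T := (degreeLTFinset Fq n ×ˢ degreeLTFinset Fq n).filter A
  have h1 := T.card_filter_add_card_filter_not (fun ab => homogEval f ab.1 ab.2 = 0)
  have h2 : (T.filter (fun ab => homogEval f ab.1 ab.2 = 0)).card ≤
      (f.natDegree + 1) * Fintype.card Fq ^ n :=
    (Finset.card_le_card (Finset.filter_subset_filter _ (Finset.filter_subset _ _))).trans
      (card_homogEval_eq_zero_le hf n)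
  rw [← h1, abs_sub_comm, abs_of_nonneg (by push_cast; simp)]
  have h3 : ((T.filter (fun ab => homogEval f ab.1 ab.2 = 0)).card : ℝ) ≤
      (f.natDegree + 1) * (Fintype.card Fq : ℝ) ^ n := by exact_mod_cast h2
  push_cast
  simpa using h3

lemma abs_card_coprimePairs_sub_le (hf : f ≠ 0) (hmonic : ℓ.Monic) {n : ℕ}
    (hn : ℓ.natDegree ≤ n) :
    |((coprimePairs f ℓ n).card : ℝ) - ((Fintype.card Fq : ℝ) ^ n) ^ 2 *
      (1 - (((Fintype.card Fq : ℝ) ^ ℓ.natDegree)⁻¹) ^ 2)| ≤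
      (f.natDegree + 1) * (Fintype.card Fq : ℝ) ^ n := by
  have h := abs_card_filter_homogEval_ne_zero_sub_le hf n
    (fun ab : Fq[X] × Fq[X] => ¬ (ℓ ∣ ab.1 ∧ ℓ ∣ ab.2))
  rw [Finset.filter_filter] at h
  rw [← card_filter_primitive hmonic hn, coprimePairs]
  convert h

variable (f ℓ) in
/-- The density among all pairs of the pairs `(a,b)` with `ℓ ∤ gcd(a,b)` and `ℓ ^ k ∣ F(a,b)`. -/
def rootDensity (k : ℕ) : ℝ :=
  rootCount f ℓ k * (((Fintype.card Fq : ℝ) ^ ℓ.natDegree) ^ k)⁻¹ *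
    (1 - ((Fintype.card Fq : ℝ) ^ ℓ.natDegree)⁻¹)

lemma abs_card_filter_coprimePairs_sub_le (hf : f ≠ 0) (hmonic : ℓ.Monic) (hirr : Irreducible ℓ)
    {k n : ℕ} (hk : 1 ≤ k) (hn : k * ℓ.natDegree ≤ n) :
    |(((coprimePairs f ℓ n).filter (fun ab => ℓ ^ k ∣ homogEval f ab.1 ab.2)).card : ℝ) -
      rootDensity f ℓ k * ((Fintype.card Fq : ℝ) ^ n) ^ 2| ≤
      (f.natDegree + 1) * (Fintype.card Fq : ℝ) ^ n := by
  have h := abs_card_filter_homogEval_ne_zero_sub_le hf n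
    (fun ab : Fq[X] × Fq[X] => ¬ (ℓ ∣ ab.1 ∧ ℓ ∣ ab.2) ∧ ℓ ^ k ∣ homogEval f ab.1 ab.2)
  have h2 := card_filter_primitive_pow_dvd (f := f) hmonic hirr hk hn
  rw [rootDensity, ← h2]
  convert h using 4
  · rw [coprimePairs, Finset.filter_filter, Finset.filter_filter]
    congr 1
    ext ab
    simp only [Finset.mem_filter]
    tauto
  · congr!

lemma card_filter_coprimePairs_le (hmonic : ℓ.Monic) (hirr : Irreducible ℓ)
    {i k n : ℕ} (hi : 1 ≤ i) (hik : i ≤ k) (hn : i * ℓ.natDegree ≤ n) :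
    (((coprimePairs f ℓ n).filter (fun ab => ℓ ^ k ∣ homogEval f ab.1 ab.2)).card : ℝ) ≤
      rootDensity f ℓ i * ((Fintype.card Fq : ℝ) ^ n) ^ 2 := by
  rw [rootDensity, ← card_filter_primitive_pow_dvd (f := f) hmonic hirr hi hn, Nat.cast_le]
  apply Finset.card_le_card
  intro ab hab
  simp only [coprimePairs, Finset.mem_filter] at hab ⊢
  exact ⟨hab.1.1, hab.1.2.1, (pow_dvd_pow _ hik).trans hab.2⟩

lemma one_lt_card_pow_natDegree (hirr : Irreducible ℓ) :
    (1 : ℝ) < (Fintype.card Fq : ℝ) ^ ℓ.natDegree :=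
  one_lt_pow₀ (by exact_mod_cast Fintype.one_lt_card) hirr.natDegree_pos.ne'

lemma rootDensity_nonneg (hirr : Irreducible ℓ) (k : ℕ) : 0 ≤ rootDensity f ℓ k := by
  have := inv_le_one_of_one_le₀ (one_lt_card_pow_natDegree hirr).le
  have : 0 ≤ 1 - ((Fintype.card Fq : ℝ) ^ ℓ.natDegree)⁻¹ := by linarith
  rw [rootDensity]
  positivity

lemma rootDensity_le (hirr : Irreducible ℓ) {C : ℕ} {k : ℕ} (hC : rootCount f ℓ k ≤ C) :
    rootDensity f ℓ k ≤ C * (((Fintype.card Fq : ℝ) ^ ℓ.natDegree) ^ k)⁻¹ := by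
  have h1 : (0 : ℝ) ≤ ((Fintype.card Fq : ℝ) ^ ℓ.natDegree)⁻¹ := by positivity
  have h2 := inv_le_one_of_one_le₀ (one_lt_card_pow_natDegree hirr).le
  have h3 : (rootCount f ℓ k : ℝ) ≤ C := by exact_mod_cast hC
  rw [rootDensity]
  refine (mul_le_of_le_one_right (by positivity) (by linarith)).trans ?_
  gcongr

/-- The sum of the valuations of `F(a,b)` over pairs of degree less than `n` is given, up to a
negligible error, by the root densities. -/
lemma exists_abs_sum_multiplicity_sub_le (hf : f ≠ 0) (hmonic : ℓ.Monic) (hirr : Irreducible ℓ)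
    {C : ℕ} (hC : ∀ k, rootCount f ℓ k ≤ C) :
    ∃ E : ℝ, ∀ n : ℕ, ℓ.natDegree ≤ n →
      |∑ ab ∈ coprimePairs f ℓ n, (multiplicity ℓ (homogEval f ab.1 ab.2) : ℝ) -
        (∑ j ∈ Finset.range (n / ℓ.natDegree), rootDensity f ℓ (j + 1)) *
          ((Fintype.card Fq : ℝ) ^ n) ^ 2| ≤ E * n * (Fintype.card Fq : ℝ) ^ n := by
  obtain ⟨D, hD⟩ := exists_natDegree_homogEval_le f
  set e := ℓ.natDegree with he
  have he0 : 0 < e := hirr.natDegree_pos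
  set q : ℝ := (Fintype.card Fq : ℝ) with hq
  have hq1 : 1 < q := by rw [hq]; exact_mod_cast Fintype.one_lt_card (α := Fq)
  refine ⟨(f.natDegree + 1) + (D + f.natDegree + 1) * (C * q ^ e), fun n hn => ?_⟩
  set Q := q ^ n with hQ
  have hQ0 : 0 < Q := by positivity
  set k₀ := n / e with hk₀
  have hk₀1 : 1 ≤ k₀ := (Nat.one_le_div_iff he0).2 hn
  have hk₀n : k₀ * e ≤ n := Nat.div_mul_le_self n e
  have hk₀n' : k₀ ≤ n := Nat.div_le_self n e
  set K := D + f.natDegree * n + n with hK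
  set M : ℕ → ℝ := fun j =>
    (((coprimePairs f ℓ n).filter (fun ab => ℓ ^ (j + 1) ∣ homogEval f ab.1 ab.2)).card : ℝ)
  have hsum : ∑ ab ∈ coprimePairs f ℓ n, (multiplicity ℓ (homogEval f ab.1 ab.2) : ℝ) =
      ∑ j ∈ Finset.range K, M j := by
    have h1 : ∀ ab ∈ coprimePairs f ℓ n, multiplicity ℓ (homogEval f ab.1 ab.2) =
        ∑ j ∈ Finset.range K, if ℓ ^ (j + 1) ∣ homogEval f ab.1 ab.2 then 1 else 0 := by
      intro ab hab
      simp only [coprimePairs, Finset.mem_filter, Finset.mem_product, mem_degreeLTFinset] at hab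
      exact multiplicity_eq_sum hirr hab.2.2 ((hD n ab.1 ab.2
        (natDegree_le_of_degree_le hab.1.1.le) (natDegree_le_of_degree_le hab.1.2.le)).trans
        (by omega))
    rw [← Nat.cast_sum, Finset.sum_congr rfl h1, Finset.sum_comm, Nat.cast_sum]
    simp only [M, Finset.card_filter]
  have hmain : |∑ j ∈ Finset.range k₀, M j -
      (∑ j ∈ Finset.range k₀, rootDensity f ℓ (j + 1)) * Q ^ 2| ≤
      n * ((f.natDegree + 1) * Q) := by
    rw [Finset.sum_mul, ← Finset.sum_sub_distrib]
    refine (Finset.abs_sum_le_sum_abs _ _).trans ?_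
    refine (Finset.sum_le_card_nsmul _ _ ((f.natDegree + 1) * Q) fun j hj => ?_).trans ?_
    · rw [Finset.mem_range] at hj
      exact abs_card_filter_coprimePairs_sub_le hf hmonic hirr (by omega)
        ((Nat.mul_le_mul_right e hj).trans hk₀n)
    · rw [Finset.card_range, nsmul_eq_mul]
      gcongr
  have hdens : rootDensity f ℓ k₀ * Q ^ 2 ≤ C * q ^ e * Q := by
    have h1 := rootDensity_le hirr (hC k₀)
    have h2 : Q ≤ (q ^ e) ^ k₀ * q ^ e := by
      rw [← pow_mul, ← pow_add, hQ]
      refine pow_le_pow_right₀ hq1.le ?_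
      have := Nat.lt_mul_div_succ n he0
      rw [Nat.mul_add, mul_one] at this
      exact this.le
    have h3 : ((q ^ e) ^ k₀)⁻¹ * Q ≤ q ^ e := by
      rw [inv_mul_le_iff₀ (by positivity)]
      exact h2
    calc rootDensity f ℓ k₀ * Q ^ 2 ≤ C * ((q ^ e) ^ k₀)⁻¹ * Q ^ 2 := by gcongr
      _ = C * (((q ^ e) ^ k₀)⁻¹ * Q) * Q := by ring
      _ ≤ C * q ^ e * Q := by gcongr
  have hn1 : (1 : ℝ) ≤ n := by exact_mod_cast (by omega : 1 ≤ n)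
  have htail : ∑ j ∈ Finset.Ico k₀ K, M j ≤
      (D + f.natDegree + 1) * n * (C * q ^ e * Q) := by
    refine (Finset.sum_le_card_nsmul _ _ (C * q ^ e * Q) fun j hj => ?_).trans ?_
    · rw [Finset.mem_Ico] at hj
      exact (card_filter_coprimePairs_le hmonic hirr hk₀1 (by omega) hk₀n).trans hdens
    · rw [Nat.card_Ico, nsmul_eq_mul]
      gcongr
      have h1 : ((K - k₀ : ℕ) : ℝ) ≤ K := by exact_mod_cast Nat.sub_le _ _
      have h2 : (K : ℝ) = D + f.natDegree * n + n := by rw [hK]; push_cast; ring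
      have h3 : (D : ℝ) ≤ D * n := le_mul_of_one_le_right (by positivity) hn1
      nlinarith
  have htail0 : 0 ≤ ∑ j ∈ Finset.Ico k₀ K, M j := Finset.sum_nonneg fun j _ => by positivity
  rw [hsum, ← Finset.sum_range_add_sum_Ico _ (by omega : k₀ ≤ K), add_sub_right_comm]
  refine (abs_add_le _ _).trans ?_
  rw [abs_of_nonneg htail0]
  calc _ ≤ n * ((f.natDegree + 1) * Q) + (D + f.natDegree + 1) * n * (C * q ^ e * Q) :=
        add_le_add hmain htail
    _ = _ := by ring

lemma summable_rootDensity (hmonic : ℓ.Monic) (hirr : Irreducible ℓ)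
    (hsep : (f.map (algebraMap Fq[X] (RatFunc Fq))).Separable) :
    Summable (fun j => rootDensity f ℓ (j + 1)) := by
  obtain ⟨C, hC⟩ := exists_rootCount_le hmonic hirr hsep
  refine ((summable_nat_add_iff 1).2 ?_ : Summable (fun j => rootDensity f ℓ (j + 1)))
  refine Summable.of_nonneg_of_le (rootDensity_nonneg hirr)
    (fun k => rootDensity_le hirr (hC k)) ?_
  refine Summable.mul_left _ ?_
  simpa only [inv_pow] using (summable_geometric_of_lt_one (by positivity)
    (inv_lt_one_of_one_lt₀ (one_lt_card_pow_natDegree hirr)))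

lemma tendsto_sum_multiplicity_div (hmonic : ℓ.Monic) (hirr : Irreducible ℓ)
    (hsep : (f.map (algebraMap Fq[X] (RatFunc Fq))).Separable) :
    Tendsto (fun n : ℕ =>
      (∑ ab ∈ coprimePairs f ℓ n, (multiplicity ℓ (homogEval f ab.1 ab.2) : ℝ)) /
        ((coprimePairs f ℓ n).card : ℝ)) atTop
      (nhds ((∑' j, rootDensity f ℓ (j + 1)) /
        (1 - (((Fintype.card Fq : ℝ) ^ ℓ.natDegree)⁻¹) ^ 2))) := by
  have hf : f ≠ 0 := by
    rintro rfl
    exact not_separable_zero (by simpa using hsep)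
  obtain ⟨C, hC⟩ := exists_rootCount_le hmonic hirr hsep
  obtain ⟨E, hE⟩ := exists_abs_sum_multiplicity_sub_le hf hmonic hirr hC
  set q : ℝ := (Fintype.card Fq : ℝ) with hq
  have hq1 : 1 < q := by rw [hq]; exact_mod_cast Fintype.one_lt_card (α := Fq)
  have hP : 1 < q ^ ℓ.natDegree := one_lt_card_pow_natDegree hirr
  have hratio : Tendsto (fun n : ℕ => (n : ℝ) / q ^ n) atTop (nhds 0) := by
    simpa using tendsto_pow_const_div_const_pow_of_one_lt 1 hq1
  have hinv : Tendsto (fun n : ℕ => (q ^ n)⁻¹) atTop (nhds 0) := by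
    exact tendsto_inv_atTop_zero.comp (tendsto_pow_atTop_atTop_of_one_lt hq1)
  have hsum : Tendsto (fun n : ℕ => ∑ j ∈ Finset.range (n / ℓ.natDegree), rootDensity f ℓ (j + 1))
      atTop (nhds (∑' j, rootDensity f ℓ (j + 1))) :=
    (summable_rootDensity hmonic hirr hsep).hasSum.tendsto_sum_nat.comp
      (Nat.tendsto_div_const_atTop hirr.natDegree_pos.ne')
  have hnum : Tendsto (fun n : ℕ =>
      (∑ ab ∈ coprimePairs f ℓ n, (multiplicity ℓ (homogEval f ab.1 ab.2) : ℝ)) / (q ^ n) ^ 2)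
      atTop (nhds (∑' j, rootDensity f ℓ (j + 1))) := by
    refine tendsto_of_tendsto_of_dist hsum ?_
    have hb : Tendsto (fun n : ℕ => E * ((n : ℝ) / q ^ n)) atTop (nhds 0) := by
      simpa using hratio.const_mul E
    refine squeeze_zero' (Eventually.of_forall fun _ => dist_nonneg) ?_ hb
    filter_upwards [eventually_ge_atTop ℓ.natDegree] with n hn
    have hQ : 0 < q ^ n := by positivity
    rw [dist_comm, Real.dist_eq, div_sub' (by positivity), abs_div, abs_of_pos (pow_pos hQ 2),
      div_le_iff₀ (pow_pos hQ 2), mul_comm ((q ^ n) ^ 2)]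
    refine (hE n hn).trans (le_of_eq ?_)
    field_simp
  have hden : Tendsto (fun n : ℕ => ((coprimePairs f ℓ n).card : ℝ) / (q ^ n) ^ 2)
      atTop (nhds (1 - ((q ^ ℓ.natDegree)⁻¹) ^ 2)) := by
    refine tendsto_of_tendsto_of_dist tendsto_const_nhds ?_
    have hb : Tendsto (fun n : ℕ => (f.natDegree + 1) * (q ^ n)⁻¹) atTop (nhds 0) := by
      simpa using hinv.const_mul ((f.natDegree : ℝ) + 1)
    refine squeeze_zero' (Eventually.of_forall fun _ => dist_nonneg) ?_ hb
    filter_upwards [eventually_ge_atTop ℓ.natDegree] with n hn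
    have hQ : 0 < q ^ n := by positivity
    rw [dist_comm, Real.dist_eq, div_sub' (by positivity), abs_div, abs_of_pos (pow_pos hQ 2),
      div_le_iff₀ (pow_pos hQ 2)]
    refine (abs_card_coprimePairs_sub_le hf hmonic hn).trans (le_of_eq ?_)
    rw [← hq]
    field_simp
  have hne : 1 - ((q ^ ℓ.natDegree)⁻¹) ^ 2 ≠ 0 := by
    have h1 : (q ^ ℓ.natDegree)⁻¹ < 1 := inv_lt_one_of_one_lt₀ hP
    have h2 : 0 < (q ^ ℓ.natDegree)⁻¹ := by positivity
    nlinarith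
  refine (hnum.div hden hne).congr fun n => ?_
  simp only [Pi.div_apply]
  rw [div_div_div_cancel_right₀ (by positivity)]

lemma coe_coprimePairs (N : ℕ) :
    (coprimePairs f ℓ (N + 1) : Set (Fq[X] × Fq[X])) =
      {ab | ¬ (ℓ ∣ ab.1 ∧ ℓ ∣ ab.2) ∧ homogEval f ab.1 ab.2 ≠ 0 ∧
        ab.1.degree ≤ (N : WithBot ℕ) ∧ ab.2.degree ≤ (N : WithBot ℕ)} := by
  have h : ∀ p : Fq[X], p.degree < ((N + 1 : ℕ) : WithBot ℕ) ↔ p.degree ≤ (N : WithBot ℕ) := by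
    intro p
    rw [degree_lt_iff_coeff_zero, degree_le_iff_coeff_zero]
    simp only [Nat.cast_lt, Nat.succ_le_iff]
  ext ab
  simp only [coprimePairs, Finset.coe_filter, Finset.mem_product, mem_degreeLTFinset, h,
    Set.mem_ofPred_eq]
  tauto

lemma tsum_rootPairs (hmonic : ℓ.Monic) (hirr : Irreducible ℓ)
    (hsep : (f.map (algebraMap Fq[X] (RatFunc Fq))).Separable) :
    ∑' x : rootPairs f ℓ,
      (((Fintype.card Fq : ℝ) ^ ℓ.natDegree) ^ ((x : Bool × Fq[X] × ℕ).2.2))⁻¹ *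
        ((Fintype.card Fq : ℝ) ^ ℓ.natDegree / ((Fintype.card Fq : ℝ) ^ ℓ.natDegree + 1)) =
      (∑' j, rootDensity f ℓ (j + 1)) /
        (1 - (((Fintype.card Fq : ℝ) ^ ℓ.natDegree)⁻¹) ^ 2) := by
  have hP := one_lt_card_pow_natDegree hirr
  have hterm : ∀ j, rootCount f ℓ (j + 1) * ((((Fintype.card Fq : ℝ) ^ ℓ.natDegree) ^ (j + 1))⁻¹ *
      ((Fintype.card Fq : ℝ) ^ ℓ.natDegree / ((Fintype.card Fq : ℝ) ^ ℓ.natDegree + 1))) =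
      rootDensity f ℓ (j + 1) / (1 - (((Fintype.card Fq : ℝ) ^ ℓ.natDegree)⁻¹) ^ 2) := by
    intro j
    rw [rootDensity]
    generalize (Fintype.card Fq : ℝ) ^ ℓ.natDegree = P at hP ⊢
    have h1 : 1 - P⁻¹ ^ 2 = (1 - P⁻¹) * ((P + 1) / P) := by field_simp; ring
    have h2 : 1 - P⁻¹ ≠ 0 := by
      have := inv_lt_one_of_one_lt₀ hP
      linarith
    rw [h1]
    generalize 1 - P⁻¹ = u at h2 ⊢
    field_simp
  have hs := (summable_rootDensity hmonic hirr hsep).div_const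
    (1 - (((Fintype.card Fq : ℝ) ^ ℓ.natDegree)⁻¹) ^ 2)
  have h := hasSum_rootPairs (f := f) (ℓ := ℓ)
    (w := fun k => (((Fintype.card Fq : ℝ) ^ ℓ.natDegree) ^ k)⁻¹ *
      ((Fintype.card Fq : ℝ) ^ ℓ.natDegree / ((Fintype.card Fq : ℝ) ^ ℓ.natDegree + 1)))
    (fun k => by positivity) (by simpa only [hterm] using hs)
  rw [h.tsum_eq, ← tsum_div_const]
  exact tsum_congr hterm

end RootCount

end PolynomialCounting

/-- Under the hypotheses of Proposition `ca`, the average of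
`v_ℓ(F(a,b))` over `ℓ`-coprime pairs `(a,b)` with `F(a,b) ≠ 0` exists and equals
`Σ_{(r,k) ∈ S(f,ℓ)} Norm(ℓ)^{-k} · Norm(ℓ)/(Norm(ℓ)+1)`. -/
theorem average_valuation_homogeneous
    (Fq : Type*) [Field Fq] [Fintype Fq]
    (f : Polynomial (Polynomial Fq)) (d : ℕ) (hd : f.natDegree = d) (hd1 : 1 ≤ d)
    (hsep : (f.map (algebraMap (Polynomial Fq) (RatFunc Fq))).Separable)
    (ℓ : Polynomial Fq) (hmonic : ℓ.Monic) (hirr : Irreducible ℓ)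
    (hcont : ∃ i, ¬ ℓ ∣ f.coeff i) :
    Filter.Tendsto (fun N : ℕ =>
        (∑ᶠ ab ∈ {ab : Polynomial Fq × Polynomial Fq | ¬ (ℓ ∣ ab.1 ∧ ℓ ∣ ab.2) ∧
            homogEval f ab.1 ab.2 ≠ 0 ∧
            ab.1.degree ≤ (N : WithBot ℕ) ∧ ab.2.degree ≤ (N : WithBot ℕ)},
          (multiplicity ℓ (homogEval f ab.1 ab.2) : ℝ)) /
        (({ab : Polynomial Fq × Polynomial Fq | ¬ (ℓ ∣ ab.1 ∧ ℓ ∣ ab.2) ∧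
            homogEval f ab.1 ab.2 ≠ 0 ∧
            ab.1.degree ≤ (N : WithBot ℕ) ∧ ab.2.degree ≤ (N : WithBot ℕ)}).ncard : ℝ))
      Filter.atTop
      (nhds (∑' x : rootPairs f ℓ,
        (((Fintype.card Fq : ℝ) ^ ℓ.natDegree) ^ ((x : Bool × Polynomial Fq × ℕ).2.2))⁻¹ *
          ((Fintype.card Fq : ℝ) ^ ℓ.natDegree / ((Fintype.card Fq : ℝ) ^ ℓ.natDegree + 1)))) := by
  rw [tsum_rootPairs hmonic hirr hsep]
  refine ((tendsto_sum_multiplicity_div hmonic hirr hsep).comp (tendsto_add_atTop_nat 1)).congr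
    fun N => ?_
  rw [← coe_coprimePairs, finsum_mem_coe_finset, Set.ncard_coe_finset]
  rfl
end
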